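/- arXiv:2501.02358 — 3 statements merged into one kernel-verified Lean document; each statement's English description precedes it below -/
import Mathlib

section
/- Let P_l be the polynomials generated by the three-term recurrence with real coefficients α_l and positive coefficients β_l, γ_l, ρ_l, and let d_l be as defined. Then there exists a finite positive Borel measure μ on ℝ whose support is an infinite set such that d_l ∫_ℝ P_l(λ) P_m(λ) dμ(λ) = δ_{lm} for all l, m ∈ ℕ, where δ_{lm} is the Kronecker delta. -/
namespace DiscPaper

open Polynomial in
/-- STATEMENT SETUP: the polynomials `P_l` generated by the three-term recurrence
`γ_{l-1} P_{l-1} + α_l P_l + β_l P_{l+1} = λ ρ_l P_l` with `P_{-1} = 0`, `P_0 = 1`. -/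
structure Recurrence (α β γ ρ : ℕ → ℝ) (P : ℕ → Polynomial ℝ) : Prop where
  hβ : ∀ l, 0 < β l
  hγ : ∀ l, 0 < γ l
  hρ : ∀ l, 0 < ρ l
  hP0 : P 0 = 1
  hrec0 : C (α 0) * P 0 + C (β 0) * P 1 = X * (C (ρ 0) * P 0)
  hrec : ∀ l : ℕ,
    C (γ l) * P l + C (α (l + 1)) * P (l + 1) + C (β (l + 1)) * P (l + 2) =
      X * (C (ρ (l + 1)) * P (l + 1))

/-- Gauss quadrature from a symmetric Jacobi matrix. -/
lemma gauss_sym (a b : ℕ → ℝ) (hb : ∀ l, b l ≠ 0) (p : ℕ → ℝ → ℝ) (h0 : ∀ x, p 0 x = 1)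
    (h1 : ∀ x, a 0 * p 0 x + b 0 * p 1 x = x * p 0 x)
    (h2 : ∀ l x, b l * p l x + a (l + 1) * p (l + 1) x + b (l + 1) * p (l + 2) x
      = x * p (l + 1) x) (N : ℕ) (hN : 0 < N) :
    ∃ w x : Fin N → ℝ, (∀ i, 0 ≤ w i) ∧ ∀ k m, k < N → m < N →
      ∑ i, w i * (p k (x i) * p m (x i)) = if k = m then 1 else 0 := by
  classical
  let J : Matrix (Fin N) (Fin N) ℝ := fun i j =>
    (if (j : ℕ) = i then a i else 0) + (if (j : ℕ) = i + 1 then b i else 0)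
      + (if (i : ℕ) = j + 1 then b j else 0)
  have hJ : J.IsHermitian := by
    refine Matrix.IsHermitian.ext fun i j => ?_
    simp only [J, star_trivial]
    by_cases h : (i : ℕ) = j
    · simp [h]
    · have h' : ¬ (j : ℕ) = i := fun e => h e.symm
      simp only [h, h', if_false]; ring
  let v : Fin N → Fin N → ℝ := fun i k => hJ.eigenvectorBasis i k
  let x := hJ.eigenvalues
  have hev : ∀ i, J.mulVec (v i) = x i • v i := fun i => hJ.mulVec_eigenvectorBasis i
  -- action of `J` on extended vectors
  have hsum : ∀ i (k : ℕ) (hk : k < N), ∑ j : Fin N, J ⟨k, hk⟩ j * v i j = x i * v i ⟨k, hk⟩ := by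
    intro i k hk
    have := congrFun (hev i) ⟨k, hk⟩
    simpa [Matrix.mulVec, dotProduct] using this
  let e : Fin N → ℕ → ℝ := fun i k => if h : k < N then v i ⟨k, h⟩ else 0
  have hev' : ∀ i j, v i j = e i j := fun i j => by simp [e]
  have hs2 : ∀ i (k : ℕ), k < N → ∑ j ∈ Finset.range N, ((if j = k then a k else 0)
      + (if j = k + 1 then b k else 0) + (if k = j + 1 then b j else 0)) * e i j
      = x i * e i k := by
    intro i k hk
    have := hsum i k hk
    simp only [hev', J] at this
    rw [← this, Finset.sum_range]
  have hp : ∀ i k, k < N → e i k = p k (x i) * e i 0 := by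
    intro i k
    induction k using Nat.strong_induction_on with
    | _ k ih =>
      intro hk
      match k, ih, hk with
      | 0, _, _ => simp [h0]
      | 1, ih, hk =>
        have := hs2 i 0 hN
        have h3 := h1 (x i)
        simp only [add_mul, ite_mul, zero_mul, Finset.sum_add_distrib, Finset.sum_ite_eq',
          Finset.mem_range, hN, hk, zero_add, if_true, if_false, add_zero, Finset.sum_const_zero,
          (Nat.succ_ne_zero _).symm] at this
        rw [h0] at h3
        apply mul_left_cancel₀ (hb 0)
        linear_combination this - e i 0 * h3
      | l + 2, ih, hk =>
        have hl1 : l + 1 < N := by omega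
        have hl : l < N := by omega
        have := hs2 i (l + 1) hl1
        have h3 := h2 l (x i)
        simp only [add_mul, ite_mul, zero_mul, Finset.sum_add_distrib, Finset.sum_ite_eq',
          Finset.sum_ite_eq, Nat.add_right_cancel_iff,
          Finset.mem_range, hl1, hl, hk, if_true, add_assoc, Nat.reduceAdd] at this
        rw [ih l (by omega) hl, ih (l + 1) (by omega) hl1] at this
        apply mul_left_cancel₀ (hb (l + 1))
        linear_combination this - e i 0 * h3
  refine ⟨fun i => e i 0 ^ 2, x, fun i => sq_nonneg _, fun k m hk hm => ?_⟩
  have hU := (Matrix.mem_unitaryGroup_iff).1 hJ.eigenvectorUnitary.2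
  have hU' := congrFun (congrFun hU ⟨k, hk⟩) ⟨m, hm⟩
  rw [Matrix.mul_apply, Matrix.one_apply] at hU'
  simp only [Fin.mk.injEq] at hU'
  rw [← hU']
  refine Finset.sum_congr rfl fun i _ => ?_
  have e1 : (hJ.eigenvectorUnitary : Matrix (Fin N) (Fin N) ℝ) ⟨k, hk⟩ i = e i k := by
    rw [hJ.eigenvectorUnitary_apply]; exact hev' i ⟨k, hk⟩
  have e2 : (star (hJ.eigenvectorUnitary : Matrix (Fin N) (Fin N) ℝ)) i ⟨m, hm⟩ = e i m := by
    rw [Matrix.star_apply, hJ.eigenvectorUnitary_apply]; exact hev' i ⟨m, hm⟩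
  rw [e1, e2, hp i k hk, hp i m hm]; ring

open MeasureTheory Filter Topology in
lemma trunc_bound (M t : ℝ) (hM : 0 < M) : |max (-M) (min t M) - t| ≤ t ^ 2 / M := by
  rw [le_div_iff₀ hM]
  rcases le_total t M with h | h
  · rw [min_eq_left h]
    rcases le_total (-M) t with h' | h'
    · rw [max_eq_right h']; simp; positivity
    · rw [max_eq_left h', abs_of_nonneg (by linarith)]; nlinarith
  · rw [min_eq_right h, max_eq_right (by linarith), abs_of_nonpos (by linarith)]; nlinarith

open MeasureTheory Filter Topology in
lemma exists_limit (ν : ℕ → ProbabilityMeasure ℝ) (L : Polynomial ℝ → ℝ)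
    (hint : ∀ n (q : Polynomial ℝ), Integrable (fun x => q.eval x) (ν n : Measure ℝ))
    (hL : ∀ q : Polynomial ℝ, ∀ᶠ n in atTop, ∫ x, q.eval x ∂(ν n : Measure ℝ) = L q) :
    ∃ μ : ProbabilityMeasure ℝ, ∀ q : Polynomial ℝ,
      Integrable (fun x => q.eval x) (μ : Measure ℝ) ∧
      ∫ x, q.eval x ∂(μ : Measure ℝ) = L q := by
  set F : Ultrafilter ℕ := hyperfilter ℕ
  have hF : (F : Filter ℕ) ≤ atTop := Nat.hyperfilter_le_atTop
  -- compactness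
  have hu : Tendsto (fun n : ℕ => Real.toNNReal (L (Polynomial.X ^ 2) / ((n : ℝ) + 1) ^ 2))
      atTop (𝓝 0) := by
    rw [← Real.toNNReal_zero]
    refine tendsto_real_toNNReal ?_
    refine Tendsto.div_atTop tendsto_const_nhds ?_
    refine (tendsto_pow_atTop (by norm_num)).comp ?_
    exact tendsto_atTop_add_const_right _ _ tendsto_natCast_atTop_atTop
  have hcomp := isCompact_setOfPred_probabilityMeasure_mass_eq_compl_isCompact_le (E := ℝ) hu
    (K := fun n => Set.Icc (-((n : ℝ) + 1)) ((n : ℝ) + 1)) (fun n => isCompact_Icc)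
    (Or.inl inferInstance)
  obtain ⟨μ, -, hμ⟩ := hcomp.ultrafilter_le_nhds (F.map ν) (by
    rw [le_principal_iff]
    change ∀ᶠ n in (F : Filter ℕ), ν n ∈ _
    filter_upwards [hF (hL (Polynomial.X ^ 2))] with n hn
    intro k
    have hk : (0:ℝ) < (k:ℝ) + 1 := by positivity
    have h1 := mul_meas_ge_le_integral_of_nonneg (μ := (ν n : Measure ℝ))
      (f := fun x => (Polynomial.X ^ 2 : Polynomial ℝ).eval x)
      (Eventually.of_forall (fun x => by simp; positivity)) (hint n _) (((k : ℝ) + 1) ^ 2)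
    rw [hn] at h1
    have h2 : (ν n : Measure ℝ).real (Set.Icc (-((k : ℝ) + 1)) ((k : ℝ) + 1))ᶜ
        ≤ L (Polynomial.X ^ 2) / ((k : ℝ) + 1) ^ 2 := by
      rw [le_div_iff₀ (by positivity), mul_comm]
      refine le_trans ?_ h1
      gcongr
      · exact measure_ne_top _ _
      · intro x hx
        simp only [Set.mem_compl_iff, Set.mem_Icc, not_and_or, not_le] at hx
        simp only [Set.mem_ofPred_eq, Polynomial.eval_pow, Polynomial.eval_X]
        rcases hx with h | h <;> nlinarith
    rw [← NNReal.coe_le_coe, Real.coe_toNNReal']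
    exact le_max_of_le_left h2)
  have hconv : Tendsto ν F (𝓝 μ) := hμ
  rw [ProbabilityMeasure.tendsto_iff_forall_integral_tendsto] at hconv
  -- truncations
  have key : ∀ (q : Polynomial ℝ) (M : ℝ), 0 < M →
      Integrable (fun x => max (-M) (min (q.eval x) M)) (μ : Measure ℝ) ∧
      |∫ x, max (-M) (min (q.eval x) M) ∂(μ : Measure ℝ) - L q| ≤ L (q ^ 2) / M := by
    intro q M hM
    have hcont : Continuous fun x => max (-M) (min (q.eval x) M) := by fun_prop
    have hbd : ∀ x, ‖max (-M) (min (q.eval x) M)‖ ≤ M := by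
      intro x
      rw [Real.norm_eq_abs, abs_le]
      exact ⟨le_max_left _ _, max_le (by linarith) (min_le_right _ _)⟩
    have hI : ∀ m : ProbabilityMeasure ℝ,
        Integrable (fun x => max (-M) (min (q.eval x) M)) (m : Measure ℝ) := fun m =>
      Integrable.of_bound hcont.aestronglyMeasurable M (Eventually.of_forall hbd)
    refine ⟨hI μ, ?_⟩
    have ht := hconv (BoundedContinuousFunction.ofNormedAddCommGroup _ hcont M hbd)
    simp only [BoundedContinuousFunction.coe_ofNormedAddCommGroup] at ht
    refine le_of_tendsto (ht.sub_const (L q)).abs ?_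
    filter_upwards [hF (hL q), hF (hL (q ^ 2))] with n h1 h2
    rw [← h1, ← h2, ← integral_sub (hI _) (hint n q), ← integral_div]
    refine (abs_integral_le_integral_abs).trans ?_
    refine integral_mono ((hI _).sub (hint n q)).abs ((hint n (q ^ 2)).div_const M) ?_
    intro x
    simpa using trunc_bound M (q.eval x) hM
  -- squares are integrable
  have hsq : ∀ q : Polynomial ℝ, Integrable (fun x => (q ^ 2).eval x) (μ : Measure ℝ) := by
    intro q
    set r := q ^ 2 with hr
    have hr0 : ∀ x, 0 ≤ r.eval x := fun x => by simp [hr]; positivity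
    set C := L r + L (r ^ 2)
    have hb : ∀ n : ℕ, ∫⁻ x, ENNReal.ofReal (min (r.eval x) ((n : ℝ) + 1)) ∂(μ : Measure ℝ)
        ≤ ENNReal.ofReal C := by
      intro n
      have hn : (0:ℝ) < (n:ℝ) + 1 := by positivity
      obtain ⟨k1, k2⟩ := key r (n + 1) hn
      have he : ∀ x, max (-((n:ℝ) + 1)) (min (r.eval x) (n + 1)) = min (r.eval x) (n + 1) :=
        fun x => max_eq_right (by
          have : 0 ≤ min (r.eval x) ((n:ℝ) + 1) := le_min (hr0 x) hn.le
          linarith)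
      simp only [he] at k1 k2
      rw [← ofReal_integral_eq_lintegral_ofReal k1
        (Eventually.of_forall fun x => le_min (hr0 x) hn.le)]
      apply ENNReal.ofReal_le_ofReal
      have h3 := (abs_le.1 k2).2
      have h4 : 0 ≤ L (r ^ 2) / ((n:ℝ) + 1) := (abs_nonneg _).trans k2
      have h5 : 0 ≤ L (r ^ 2) := by
        have := mul_nonneg h4 hn.le
        rwa [div_mul_cancel₀ _ hn.ne'] at this
      have h6 : L (r ^ 2) / ((n:ℝ) + 1) ≤ L (r ^ 2) := div_le_self h5 (by linarith [n.cast_nonneg (α := ℝ)])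
      simp only [C]; linarith
    refine ⟨by fun_prop, ?_⟩
    rw [hasFiniteIntegral_iff_ofReal (Eventually.of_forall hr0)]
    have hlim := lintegral_liminf_le (u := atTop) (μ := (μ : Measure ℝ))
      (f := fun (n : ℕ) x => ENNReal.ofReal (min (r.eval x) ((n : ℝ) + 1)))
      (fun n => by fun_prop)
    have hpt : ∀ x, liminf (fun n : ℕ => ENNReal.ofReal (min (r.eval x) ((n : ℝ) + 1))) atTop
        = ENNReal.ofReal (r.eval x) := by
      intro x
      apply Tendsto.liminf_eq
      refine tendsto_const_nhds.congr' ?_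
      filter_upwards [tendsto_natCast_atTop_atTop.eventually_ge_atTop (r.eval x)] with n hn
      rw [min_eq_left (by linarith)]
    simp only [hpt] at hlim
    refine lt_of_le_of_lt (hlim.trans ?_) (ENNReal.ofReal_lt_top (r := C))
    exact liminf_le_of_le (by isBoundedDefault) (fun b hb' => by
      obtain ⟨n, hn⟩ := hb'.exists
      exact hn.trans (hb n))
  refine ⟨μ, fun q => ?_⟩
  have hq : Integrable (fun x => q.eval x) (μ : Measure ℝ) := by
    refine Integrable.mono' ((integrable_const (1:ℝ)).add (hsq q)) (by fun_prop)
      (Eventually.of_forall fun x => ?_)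
    simp only [Pi.add_apply, Polynomial.eval_pow, Real.norm_eq_abs]
    rw [abs_le]; constructor <;> nlinarith [sq_nonneg (q.eval x - 1), sq_nonneg (q.eval x + 1)]
  refine ⟨hq, ?_⟩
  set D := L (q ^ 2) + ∫ x, (q ^ 2).eval x ∂(μ : Measure ℝ)
  have hall : ∀ n : ℕ, |∫ x, q.eval x ∂(μ : Measure ℝ) - L q| ≤ D / ((n:ℝ) + 1) := by
    intro n
    have hn : (0:ℝ) < (n:ℝ) + 1 := by positivity
    obtain ⟨k1, k2⟩ := key q (n + 1) hn
    have h3 : |∫ x, max (-((n:ℝ) + 1)) (min (q.eval x) (n + 1)) ∂(μ : Measure ℝ)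
        - ∫ x, q.eval x ∂(μ : Measure ℝ)| ≤ (∫ x, (q ^ 2).eval x ∂(μ : Measure ℝ)) / (n + 1) := by
      rw [← integral_sub k1 hq, ← integral_div]
      refine (abs_integral_le_integral_abs).trans ?_
      refine integral_mono (k1.sub hq).abs ((hsq q).div_const _) ?_
      intro x
      simpa using trunc_bound (n + 1) (q.eval x) hn
    rw [show D / ((n:ℝ) + 1) = L (q ^ 2) / (n + 1)
      + (∫ x, (q ^ 2).eval x ∂(μ : Measure ℝ)) / (n + 1) from add_div _ _ _]
    rw [abs_le] at *
    constructor <;> linarith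
  have hz : |∫ x, q.eval x ∂(μ : Measure ℝ) - L q| ≤ 0 :=
    ge_of_tendsto' (Tendsto.div_atTop tendsto_const_nhds
      (tendsto_atTop_add_const_right _ _ tendsto_natCast_atTop_atTop)) hall
  exact sub_eq_zero.1 (abs_nonpos_iff.1 hz)

/-- Gauss quadrature for the recurrence. -/
lemma gauss_rec {α β γ ρ : ℕ → ℝ} {P : ℕ → Polynomial ℝ} (hP : Recurrence α β γ ρ P)
    (d : ℕ → ℝ) (hdpos : ∀ l, 0 < d l)
    (hds : ∀ l, d (l + 1) * (ρ l * γ l) = d l * (ρ (l + 1) * β l)) (N : ℕ) (hN : 0 < N) :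
    ∃ w x : Fin N → ℝ, (∀ i, 0 ≤ w i) ∧ ∀ k m, k < N → m < N →
      ∑ i, w i * ((P k).eval (x i) * (P m).eval (x i)) = if k = m then d 0 / d k else 0 := by
  set t : ℕ → ℝ := fun l => Real.sqrt (d l / d 0) with ht
  have htpos : ∀ l, 0 < t l := fun l => Real.sqrt_pos.2 (div_pos (hdpos l) (hdpos 0))
  have htsq : ∀ l, t l ^ 2 = d l / d 0 := fun l =>
    Real.sq_sqrt (div_pos (hdpos l) (hdpos 0)).le
  have ht0 : t 0 = 1 := by simp [ht, (hdpos 0).ne']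
  have hb2 : ∀ l, β l / ρ l * t l / t (l + 1) = γ l / ρ (l + 1) * t (l + 1) / t l := by
    intro l
    have h1 := htsq l
    have h2 := htsq (l + 1)
    have h3 := hds l
    have := htpos l
    have := htpos (l + 1)
    have := hP.hρ l
    have := hP.hρ (l + 1)
    have h0 := (hdpos 0).ne'
    rw [eq_div_iff h0] at h1 h2
    field_simp
    apply mul_right_cancel₀ h0
    linear_combination β l * ρ (l + 1) * h1 - γ l * ρ l * h2 - h3
  obtain ⟨w, x, hw, h⟩ := gauss_sym (fun l => α l / ρ l) (fun l => β l / ρ l * t l / t (l + 1))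
    (fun l => (div_pos (mul_pos (div_pos (hP.hβ l) (hP.hρ l)) (htpos l)) (htpos _)).ne')
    (fun l y => t l * (P l).eval y) (fun y => by simp [ht0, hP.hP0])
    (fun y => by
      have h := congrArg (Polynomial.eval y) hP.hrec0
      simp only [Polynomial.eval_add, Polynomial.eval_mul, Polynomial.eval_C,
        Polynomial.eval_X] at h
      have := hP.hρ 0
      have := htpos 0
      have := htpos 1
      simp only [zero_add]
      field_simp
      linear_combination h)
    (fun l y => by
      have h := congrArg (Polynomial.eval y) (hP.hrec l)
      simp only [Polynomial.eval_add, Polynomial.eval_mul, Polynomial.eval_C,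
        Polynomial.eval_X] at h
      have := hP.hρ (l + 1)
      have := htpos l
      have := htpos (l + 1)
      have := htpos (l + 2)
      simp only [hb2 l, add_assoc, Nat.reduceAdd] at h ⊢
      field_simp
      linear_combination h) N hN
  refine ⟨w, x, hw, fun k m hk hm => ?_⟩
  have h' := h k m hk hm
  have hfac : ∑ i, w i * (t k * (P k).eval (x i) * (t m * (P m).eval (x i)))
      = t k * t m * ∑ i, w i * ((P k).eval (x i) * (P m).eval (x i)) := by
    rw [Finset.mul_sum]
    exact Finset.sum_congr rfl fun i _ => by ring
  rw [hfac] at h'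
  have hk0 := (htpos k).ne'
  have hm0 := (htpos m).ne'
  split_ifs at h' ⊢ with hkm
  · subst hkm
    have h1 := htsq k
    rw [← sq, h1] at h'
    have := (hdpos k).ne'
    have := (hdpos 0).ne'
    field_simp at h' ⊢
    linear_combination h'
  · exact (mul_eq_zero.1 h').resolve_left (mul_ne_zero hk0 hm0)

/-- The `P l` span all polynomials. -/
lemma span_top {α β γ ρ : ℕ → ℝ} {P : ℕ → Polynomial ℝ} (hP : Recurrence α β γ ρ P)
    (q : Polynomial ℝ) : q ∈ Submodule.span ℝ (Set.range P) := by
  set S := Submodule.span ℝ (Set.range P)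
  have hmem : ∀ l, P l ∈ S := fun l => Submodule.subset_span ⟨l, rfl⟩
  have hX : ∀ l, Polynomial.X * P l ∈ S := by
    intro l
    have key : ∀ r ∈ S, Polynomial.X * (Polynomial.C (ρ l) * P l) = r →
        Polynomial.X * P l ∈ S := by
      intro r hr h
      have : Polynomial.X * P l = (ρ l)⁻¹ • r := by
        rw [← h, Polynomial.smul_eq_C_mul, mul_left_comm Polynomial.X, ← mul_assoc,
          ← Polynomial.C_mul, inv_mul_cancel₀ (hP.hρ l).ne', Polynomial.C_1, one_mul]
      rw [this]
      exact S.smul_mem _ hr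
    cases l with
    | zero =>
      refine key _ ?_ hP.hrec0.symm
      simp only [← Polynomial.smul_eq_C_mul]
      exact S.add_mem (S.smul_mem _ (hmem _)) (S.smul_mem _ (hmem _))
    | succ l =>
      refine key _ ?_ (hP.hrec l).symm
      simp only [← Polynomial.smul_eq_C_mul]
      exact S.add_mem (S.add_mem (S.smul_mem _ (hmem _)) (S.smul_mem _ (hmem _)))
        (S.smul_mem _ (hmem _))
  have hXS : ∀ r ∈ S, Polynomial.X * r ∈ S := by
    intro r hr
    induction hr using Submodule.span_induction with
    | mem r hr => obtain ⟨l, rfl⟩ := hr; exact hX l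
    | zero => simp
    | add r s _ _ h1 h2 => rw [mul_add]; exact S.add_mem h1 h2
    | smul c r _ h => rw [mul_smul_comm]; exact S.smul_mem _ h
  have hpow : ∀ n : ℕ, (Polynomial.X ^ n : Polynomial ℝ) ∈ S := by
    intro n
    induction n with
    | zero => rw [pow_zero, ← hP.hP0]; exact hmem 0
    | succ n ih => rw [pow_succ']; exact hXS _ ih
  induction q using Polynomial.induction_on' with
  | add p q h1 h2 => exact S.add_mem h1 h2
  | monomial n c =>
    rw [← Polynomial.C_mul_X_pow_eq_monomial, ← Polynomial.smul_eq_C_mul]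
    exact S.smul_mem _ (hpow n)

open MeasureTheory Filter in
/-- The approximating discrete probability measures. -/
lemma exists_approx {α β γ ρ : ℕ → ℝ} {P : ℕ → Polynomial ℝ} (hP : Recurrence α β γ ρ P)
    (d : ℕ → ℝ) (hdpos : ∀ l, 0 < d l)
    (hds : ∀ l, d (l + 1) * (ρ l * γ l) = d l * (ρ (l + 1) * β l)) (N : ℕ) :
    ∃ ν : ProbabilityMeasure ℝ,
      (∀ q : Polynomial ℝ, Integrable (fun x => q.eval x) (ν : Measure ℝ)) ∧
      ∀ k m, k ≤ N → m ≤ N → ∫ x, (P k * P m).eval x ∂(ν : Measure ℝ)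
        = if k = m then d 0 / d k else 0 := by
  obtain ⟨w, x, hw, h⟩ := gauss_rec hP d hdpos hds (N + 1) N.succ_pos
  have hsum : ∑ i, w i = 1 := by
    have := h 0 0 N.succ_pos N.succ_pos
    simpa [hP.hP0, (hdpos 0).ne'] using this
  let ν : Measure ℝ := ∑ i, ENNReal.ofReal (w i) • Measure.dirac (x i)
  have hν : IsProbabilityMeasure ν := by
    constructor
    simp only [ν, Measure.coe_finsetSum, Finset.sum_apply, Measure.smul_apply, measure_univ,
      smul_eq_mul, mul_one]
    rw [← ENNReal.ofReal_sum_of_nonneg (fun i _ => hw i), hsum, ENNReal.ofReal_one]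
  have hi : ∀ i, ∀ q : Polynomial ℝ, Integrable (fun x => q.eval x)
      (ENNReal.ofReal (w i) • Measure.dirac (x i)) := fun i q =>
    (integrable_dirac (by simp)).smul_measure ENNReal.ofReal_ne_top
  refine ⟨⟨ν, hν⟩, fun q => ?_, fun k m hk hm => ?_⟩
  · change Integrable (fun x => q.eval x) ν
    exact integrable_finsetSum_measure.2 fun i _ => hi i q
  · rw [← h k m (Nat.lt_succ_of_le hk) (Nat.lt_succ_of_le hm)]
    change ∫ x, (P k * P m).eval x ∂ν = _
    rw [integral_finsetSum_measure fun i _ => hi i _]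
    refine Finset.sum_congr rfl fun i _ => ?_
    rw [integral_smul_measure, integral_dirac, ENNReal.toReal_ofReal (hw i)]
    simp

/-- Favard: for the polynomials `P_l` generated by the three-term
recurrence with real `α_l` and positive `β_l, γ_l, ρ_l`, and
`d_0 = ρ_0`, `d_l = ρ_l (β_0⋯β_{l-1})/(γ_0⋯γ_{l-1})`, there exists a finite positive
Borel measure `μ` on `ℝ` with infinite support (it charges the complement of every
finite set) such that `d_l ∫ P_l P_m dμ = δ_{lm}`. -/
theorem stmt_7 (α β γ ρ : ℕ → ℝ) (P : ℕ → Polynomial ℝ)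
    (hP : Recurrence α β γ ρ P)
    (d : ℕ → ℝ)
    (hd : ∀ l, d l = ρ l * (∏ i ∈ Finset.range l, β i) / (∏ i ∈ Finset.range l, γ i)) :
    ∃ μ : MeasureTheory.Measure ℝ, MeasureTheory.IsFiniteMeasure μ ∧
      (∀ s : Set ℝ, s.Finite → μ sᶜ ≠ 0) ∧
      (∀ l m : ℕ,
        MeasureTheory.Integrable (fun x => (P l).eval x * (P m).eval x) μ) ∧
      (∀ l m : ℕ,
        d l * ∫ x, (P l).eval x * (P m).eval x ∂μ = if l = m then 1 else 0) := by
  have hdpos : ∀ l, 0 < d l := fun l => by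
    rw [hd]
    exact div_pos (mul_pos (hP.hρ l) (Finset.prod_pos fun i _ => hP.hβ i))
      (Finset.prod_pos fun i _ => hP.hγ i)
  have hds : ∀ l, d (l + 1) * (ρ l * γ l) = d l * (ρ (l + 1) * β l) := fun l => by
    have h1 : (∏ i ∈ Finset.range l, γ i) ≠ 0 :=
      (Finset.prod_pos fun i _ => hP.hγ i).ne'
    have h2 := (hP.hγ l).ne'
    rw [hd, hd, Finset.prod_range_succ, Finset.prod_range_succ]
    field_simp
  choose ν hνi hν using exists_approx hP d hdpos hds
  have hev : ∀ k m, ∀ᶠ n in Filter.atTop, ∫ x, (P k * P m).eval x ∂(ν n : MeasureTheory.Measure ℝ)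
        = if k = m then d 0 / d k else 0 := by
    intro k m
    filter_upwards [Filter.eventually_ge_atTop (max k m)] with n hn
    exact hν n k m ((le_max_left _ _).trans hn) ((le_max_right _ _).trans hn)
  have hL : ∀ q : Polynomial ℝ, ∃ c, ∀ᶠ n in Filter.atTop,
      ∫ x, q.eval x ∂(ν n : MeasureTheory.Measure ℝ) = c := by
    intro q
    have hq := span_top hP q
    induction hq using Submodule.span_induction with
    | mem r hr =>
      obtain ⟨l, rfl⟩ := hr
      refine ⟨if l = 0 then d 0 / d l else 0, (hev l 0).mono fun n hn => ?_⟩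
      rw [← hn, hP.hP0, mul_one]
    | zero => exact ⟨0, by simp⟩
    | add r s _ _ h1 h2 =>
      obtain ⟨c1, h1⟩ := h1
      obtain ⟨c2, h2⟩ := h2
      refine ⟨c1 + c2, ?_⟩
      filter_upwards [h1, h2] with n h1 h2
      rw [← h1, ← h2, ← MeasureTheory.integral_add (hνi n r) (hνi n s)]
      simp
    | smul c r _ h =>
      obtain ⟨c1, h1⟩ := h
      refine ⟨c * c1, ?_⟩
      filter_upwards [h1] with n h1
      rw [← h1, ← MeasureTheory.integral_const_mul]
      simp
  choose L hL using hL
  obtain ⟨μ, hμ⟩ := exists_limit ν L hνi hL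
  have horth : ∀ k m, ∫ x, (P k * P m).eval x ∂(μ : MeasureTheory.Measure ℝ)
      = if k = m then d 0 / d k else 0 := by
    intro k m
    rw [(hμ _).2]
    obtain ⟨n, h1, h2⟩ := ((hL (P k * P m)).and (hev k m)).exists
    rw [← h1, h2]
  have hd0 : ENNReal.ofReal (d 0)⁻¹ ≠ 0 := by
    simpa using hdpos 0
  refine ⟨ENNReal.ofReal (d 0)⁻¹ • (μ : MeasureTheory.Measure ℝ),
    MeasureTheory.Measure.smul_finite _ ENNReal.ofReal_ne_top, ?_, ?_, ?_⟩
  · intro s hs h0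
    rw [MeasureTheory.Measure.smul_apply, smul_eq_mul, mul_eq_zero] at h0
    have h0 := h0.resolve_left hd0
    have := hs.fintype
    have hli : LinearIndependent ℝ
        (fun (k : Fin (Fintype.card s + 1)) (x : s) => (P k).eval (x : ℝ)) := by
      rw [Fintype.linearIndependent_iff]
      intro g hg m
      have hz : ∫ x, (∑ k, g k * (P k * P m).eval x) ∂(μ : MeasureTheory.Measure ℝ) = 0 := by
        apply MeasureTheory.integral_eq_zero_of_ae
        have hae : ∀ᵐ x ∂(μ : MeasureTheory.Measure ℝ), x ∈ s := h0
        filter_upwards [hae] with x hx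
        have h1 := congrFun hg ⟨x, hx⟩
        simp only [Finset.sum_apply, Pi.smul_apply, smul_eq_mul, Pi.zero_apply] at h1
        simp only [Polynomial.eval_mul, ← mul_assoc, ← Finset.sum_mul, h1, zero_mul,
          Pi.zero_apply]
      rw [MeasureTheory.integral_finsetSum _ fun k _ => ((hμ _).1.const_mul _)] at hz
      simp only [MeasureTheory.integral_const_mul, horth, mul_ite, mul_zero, Fin.val_inj,
        Finset.sum_ite_eq', Finset.mem_univ, if_true] at hz
      exact (mul_eq_zero.1 hz).resolve_right (div_pos (hdpos 0) (hdpos _)).ne'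
    have := hli.fintype_card_le_finrank
    simp at this
  · intro l m
    simpa using (hμ (P l * P m)).1.smul_measure (c := ENNReal.ofReal (d 0)⁻¹)
      ENNReal.ofReal_ne_top
  · intro l m
    have := horth l m
    simp only [Polynomial.eval_mul] at this
    rw [MeasureTheory.integral_smul_measure, this,
      ENNReal.toReal_ofReal (inv_nonneg.2 (hdpos 0).le)]
    have h1 := (hdpos 0).ne'
    have h2 := (hdpos l).ne'
    split_ifs
    · rw [smul_eq_mul]; field_simp
    · simp

end DiscPaper
end

section
/- Let ψ_k(ν) = P_ν(λ_k) be as in the discrete Sturm–Liouville problem and let integers m, n satisfy 1 ≤ m ≤ n ≤ q+1. Then every nontrivial polynomial V(ν) = Σ_{k=m}^{n} a_k ψ_k(ν) with real coefficients satisfies m − 1 ≤ S^−(V) ≤ N(V) ≤ S^+(V) ≤ n − 1. -/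
namespace DiscPaper

/-- `ν` is a zero (of the first or second type) of the discrete function `f` on `[0,q]_ℤ`. -/
def IsZero (q : ℕ) (f : ℕ → ℝ) (ν : ℕ) : Prop :=
  (ν ≤ q ∧ f ν = 0) ∨ (1 ≤ ν ∧ ν ≤ q ∧ f (ν - 1) * f ν < 0)

/-- `N q f` is the number of zeros (of both types) of `f` on `[0,q]_ℤ`. -/
noncomputable def N (q : ℕ) (f : ℕ → ℝ) : ℕ := {ν : ℕ | IsZero q f ν}.ncard

/-- `N₀ q f` is the number of zeros of the first type of `f` on `[0,q]_ℤ`. -/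
noncomputable def N0 (q : ℕ) (f : ℕ → ℝ) : ℕ := {ν : ℕ | ν ≤ q ∧ f ν = 0}.ncard

/-- Number of sign changes of `g` on `[0,q]_ℤ`. -/
noncomputable def signChanges (q : ℕ) (g : ℕ → ℝ) : ℕ :=
  {ν : ℕ | 1 ≤ ν ∧ ν ≤ q ∧ g (ν - 1) * g ν < 0}.ncard

/-- `g` is obtained from `f` by replacing all its zero values on `[0,q]_ℤ` by
arbitrary nonzero values. -/
def Admissible (q : ℕ) (f g : ℕ → ℝ) : Prop :=
  (∀ ν ≤ q, g ν ≠ 0) ∧ ∀ ν ≤ q, f ν ≠ 0 → g ν = f ν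

/-- `S⁻(f)`: least number of sign changes over all admissible replacements. -/
noncomputable def Sminus (q : ℕ) (f : ℕ → ℝ) : ℕ :=
  sInf {s | ∃ g, Admissible q f g ∧ signChanges q g = s}

/-- `S⁺(f)`: largest number of sign changes over all admissible replacements. -/
noncomputable def Splus (q : ℕ) (f : ℕ → ℝ) : ℕ :=
  sSup {s | ∃ g, Admissible q f g ∧ signChanges q g = s}
/-- STATEMENT SETUP: `Λ (k-1)` is the `k`-th zero `λ_k` of
`P̃_{q+1} = P_{q+1} - η P_q`, ordered decreasingly: `λ_{q+1} < ⋯ < λ_1`. -/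
structure SLZeros (P : ℕ → Polynomial ℝ) (q : ℕ) (η : ℝ) (Λ : ℕ → ℝ) : Prop where
  anti : StrictAntiOn Λ (Set.Iic q)
  root : ∀ i ≤ q, (P (q + 1) - Polynomial.C η * P q).eval (Λ i) = 0

/-- A finite Jacobi eigenproblem, on indices `1..q+1`. -/
structure Sys (q : ℕ) (a b c L : ℕ → ℝ) (u : ℕ → ℕ → ℝ) : Prop where
  c0 : c 0 = 0
  bq : b q = 0
  cpos : ∀ l, 1 ≤ l → l ≤ q → 0 < c l
  bpos : ∀ l, l < q → 0 < b l
  anti : ∀ i j, i < j → j ≤ q → L j < L i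
  ne : ∀ i, i ≤ q → u i 1 ≠ 0
  eq : ∀ i, i ≤ q → ∀ l, l ≤ q →
    c l * u i l + a l * u i (l+1) + b l * u i (l+2) = L i * u i (l+1)

open Polynomial in
/-- auxiliary polynomials -/
noncomputable def pp (a b c : ℕ → ℝ) : ℕ → ℝ[X]
  | 0 => 0
  | 1 => 1
  | (l+2) => C (b l)⁻¹ * ((X - C (a l)) * pp a b c (l+1) - C (c l) * pp a b c l)

open Polynomial in
lemma pp_deg (a b c : ℕ → ℝ) (hb : ∀ l, 0 < b l) (l : ℕ) :
    (pp a b c l).degree < ((l : ℕ) : WithBot ℕ) ∧ (pp a b c (l+1)).degree = ((l : ℕ) : WithBot ℕ) ∧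
      0 < (pp a b c (l+1)).leadingCoeff := by
  induction l with
  | zero => simp [pp]
  | succ l ih =>
    obtain ⟨h1, h2, h3⟩ := ih
    have hd : ((X - C (a l)) * pp a b c (l+1)).degree = ((l+1 : ℕ) : WithBot ℕ) := by
      rw [degree_mul, h2, degree_X_sub_C]; push_cast; rw [add_comm]
    have hd2 : (C (c l) * pp a b c l).degree < ((X - C (a l)) * pp a b c (l+1)).degree := by
      rw [hd]
      rw [← smul_eq_C_mul]
      refine lt_of_le_of_lt (degree_smul_le _ _) (h1.trans ?_)
      exact_mod_cast Nat.lt_succ_self l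
    have hbi : (b l)⁻¹ ≠ 0 := inv_ne_zero (hb l).ne'
    refine ⟨?_, ?_, ?_⟩
    · rw [h2]; exact_mod_cast Nat.lt_succ_self l
    · rw [pp, degree_C_mul hbi, degree_sub_eq_left_of_degree_lt hd2, hd]
    · rw [pp, leadingCoeff_mul, leadingCoeff_sub_of_degree_lt hd2, leadingCoeff_mul]
      simp only [leadingCoeff_C, leadingCoeff_X_sub_C, one_mul]
      exact mul_pos (inv_pos.2 (hb l)) h3

open Polynomial in
lemma ev_pos (p : ℝ[X]) (h : 0 < p.leadingCoeff) : ∀ᶠ x in Filter.atTop, 0 < p.eval x := by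
  by_cases hd : 0 < p.degree
  · exact (p.tendsto_atTop_of_leadingCoeff_nonneg hd h.le).eventually_gt_atTop 0
  · rw [eq_C_of_degree_le_zero (not_lt.1 hd)] at h ⊢
    refine Filter.Eventually.of_forall fun x => ?_
    simpa using h

open Polynomial in
lemma top_nonneg (p : ℝ[X]) (q : ℕ) (hd : p.degree = ((q+1 : ℕ) : WithBot ℕ))
    (hl : 0 < p.leadingCoeff) (L : ℕ → ℝ) (anti : ∀ i j, i < j → j ≤ q → L j < L i)
    (hr : ∀ i ≤ q, p.eval (L i) = 0) (x : ℝ) (hx : L 0 ≤ x) : 0 ≤ p.eval x := by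
  by_contra! hneg
  have hx' : L 0 < x := lt_of_le_of_ne hx (by rintro rfl; rw [hr 0 (Nat.zero_le _)] at hneg; simp at hneg)
  obtain ⟨y, hy, hxy⟩ := ((ev_pos p hl).and (Filter.eventually_ge_atTop x)).exists
  obtain ⟨z, hz, hz0⟩ := intermediate_value_Icc hxy (p.continuous.continuousOn) ⟨hneg.le, hy.le⟩
  have hp0 : p ≠ 0 := by rintro rfl; simp at hl
  let g : ℕ → ℝ := fun i => if i ≤ q then L i else z
  have hLz : ∀ i ≤ q, L i < z := by
    intro i hi
    have : L i ≤ L 0 := by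
      rcases Nat.eq_zero_or_pos i with rfl | h
      · exact le_rfl
      · exact (anti 0 i h hi).le
    linarith [hz.1]
  have hinj : Set.InjOn g (Finset.range (q+2)) := by
    intro i hi j hj hij
    simp only [Finset.coe_range, Set.mem_Iio] at hi hj
    by_contra hne
    simp only [g] at hij
    rcases lt_or_gt_of_ne hne with h | h
    · by_cases h2 : j ≤ q
      · rw [if_pos (by omega), if_pos h2] at hij
        exact absurd hij (anti i j h h2).ne'
      · rw [if_pos (by omega), if_neg h2] at hij
        exact absurd hij (hLz i (by omega)).ne
    · by_cases h2 : i ≤ q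
      · rw [if_pos h2, if_pos (by omega)] at hij
        exact absurd hij (anti j i h h2).ne
      · rw [if_neg h2, if_pos (by omega)] at hij
        exact absurd hij (hLz j (by omega)).ne'
  have hsub : (Finset.range (q+2)).image g ⊆ p.roots.toFinset := by
    intro t ht
    obtain ⟨i, hi, rfl⟩ := Finset.mem_image.1 ht
    rw [Multiset.mem_toFinset, mem_roots hp0]
    simp only [g]
    split_ifs with h
    · exact hr i h
    · exact hz0
  have h1 := Finset.card_le_card hsub
  rw [Finset.card_image_of_injOn hinj, Finset.card_range] at h1
  have h2 := Multiset.toFinset_card_le p.roots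
  have h3 := p.card_roots'
  have h4 := natDegree_eq_of_degree_eq_some hd
  omega

open Polynomial in
lemma perron {q : ℕ} {a b c L : ℕ → ℝ} {u : ℕ → ℕ → ℝ} (h : Sys q a b c L u)
    (l : ℕ) (hl1 : 1 ≤ l) (hl : l ≤ q+1) : 0 < u 0 l / u 0 1 := by
  let b' : ℕ → ℝ := fun l => if l < q then b l else 1
  have hb' : ∀ l, 0 < b' l := by
    intro l; simp only [b']; split_ifs with hh
    · exact h.bpos l hh
    · exact one_pos
  have hb'q : b' q = 1 := by simp [b']
  let p := pp a b' c
  have hp1 : p 1 = 1 := rfl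
  have hrec : ∀ x l, b' l * (p (l+2)).eval x = (x - a l) * (p (l+1)).eval x - c l * (p l).eval x := by
    intro x l
    have : p (l+2) = C (b' l)⁻¹ * ((X - C (a l)) * p (l+1) - C (c l) * p l) := by
      simp only [p, pp]
    rw [this]
    simp only [eval_mul, eval_sub, eval_C, eval_X]
    rw [← mul_assoc, mul_inv_cancel₀ (hb' l).ne', one_mul]
  have hu : ∀ i ≤ q, ∀ l ≤ q, c l * u i l = u i 1 * (c l * (p l).eval (L i)) ∧
      u i (l+1) = u i 1 * (p (l+1)).eval (L i) := by
    intro i hi l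
    induction l with
    | zero => intro _; simp [h.c0, hp1]
    | succ l ih =>
      intro hlq
      obtain ⟨i1, i2⟩ := ih (by omega)
      refine ⟨by rw [i2]; ring, ?_⟩
      have e1 := h.eq i hi l (by omega)
      have e2 := hrec (L i) l
      have e3 : b' l = b l := by simp only [b']; rw [if_pos (by omega)]
      rw [e3] at e2
      have : b l ≠ 0 := (h.bpos l (by omega)).ne'
      apply mul_left_cancel₀ this
      rw [i1, i2] at e1
      linear_combination e1 - u i 1 * e2
  have hroot : ∀ i ≤ q, (p (q+2)).eval (L i) = 0 := by
    intro i hi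
    have e1 := h.eq i hi q le_rfl
    have e2 := hrec (L i) q
    obtain ⟨i1, i2⟩ := hu i hi q le_rfl
    rw [i1, i2, h.bq] at e1
    rw [hb'q] at e2
    apply mul_left_cancel₀ (h.ne i hi)
    linear_combination u i 1 * e2 - e1
  have hdeg := pp_deg a b' c hb'
  have htop : ∀ x, L 0 ≤ x → 0 ≤ (p (q+2)).eval x :=
    top_nonneg (p (q+2)) q (hdeg (q+1)).2.1 (hdeg (q+1)).2.2 L h.anti hroot
  have main : ∀ x, L 0 ≤ x → ∀ l ≤ q, 0 < (p (l+1)).eval x := by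
    by_contra! hcon
    obtain ⟨x0, hx0, l0, hl0, hneg⟩ := hcon
    let S : Set ℝ := ⋃ l ∈ Set.Iic q, {x | L 0 ≤ x ∧ (p (l+1)).eval x ≤ 0}
    have hScl : IsClosed S := by
      apply Set.Finite.isClosed_biUnion (Set.finite_Iic q)
      intro i _
      exact (isClosed_le continuous_const continuous_id).inter
        (isClosed_le (p (i+1)).continuous continuous_const)
    have hSne : S.Nonempty := ⟨x0, by
      simp only [S, Set.mem_iUnion]; exact ⟨l0, hl0, hx0, hneg⟩⟩
    have hSbd : BddAbove S := by
      have : ∀ᶠ x in Filter.atTop, ∀ l ∈ Set.Iic q, 0 < (p (l+1)).eval x :=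
        (Filter.eventually_all_finite (Set.finite_Iic q)).2 fun l _ => ev_pos _ (hdeg l).2.2
      obtain ⟨B, hB⟩ := Filter.eventually_atTop.1 this
      refine ⟨B, ?_⟩
      intro x hx
      simp only [S, Set.mem_iUnion] at hx
      obtain ⟨l, hl, h1, h2⟩ := hx
      by_contra! hlt
      exact absurd (hB x hlt.le l hl) (not_lt.2 h2)
    have hmem := hScl.csSup_mem hSne hSbd
    set y := sSup S with hy
    have hmem' := hmem
    simp only [S, Set.mem_iUnion] at hmem'
    obtain ⟨l1, hl1, hLy, hl1n⟩ := hmem'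
    have hgt : ∀ x, y < x → ∀ l ≤ q, 0 < (p (l+1)).eval x := by
      intro x hx l hl
      by_contra! hle
      have : x ∈ S := by
        simp only [S, Set.mem_iUnion]; exact ⟨l, hl, by linarith, hle⟩
      exact absurd (le_csSup hSbd this) (not_le.2 hx)
    have hge : ∀ l ≤ q, 0 ≤ (p (l+1)).eval y := by
      intro l hl
      have ht : Filter.Tendsto (fun x => (p (l+1)).eval x) (nhdsWithin y (Set.Ioi y))
          (nhds ((p (l+1)).eval y)) := ((p (l+1)).continuous.tendsto y).mono_left nhdsWithin_le_nhds
      refine ge_of_tendsto ht ?_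
      filter_upwards [self_mem_nhdsWithin] with x hx
      exact (hgt x hx l hl).le
    have hne : ∀ l ≤ q, (p (l+1)).eval y ≠ 0 := by
      intro l
      induction l with
      | zero => intro _; simp [hp1]
      | succ l ih =>
        intro hlq h0
        have e := hrec y (l+1)
        rw [h0] at e
        have hc := h.cpos (l+1) (by omega) hlq
        have hpl : 0 < (p (l+1)).eval y := lt_of_le_of_ne (hge l (by omega)) (ih (by omega)).symm
        have hpl2 : 0 ≤ (p (l+1+2)).eval y := by
          rcases Nat.lt_or_ge (l+1) q with hh | hh
          · exact hge (l+2) (by omega)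
          · have : l+1 = q := by omega
            rw [this]; exact htop y hLy
        nlinarith [mul_pos hc hpl, mul_nonneg (hb' (l+1)).le hpl2]
    exact hne l1 hl1 (le_antisymm hl1n (hge l1 hl1))
  obtain ⟨k, rfl⟩ : ∃ k, l = k+1 := ⟨l-1, by omega⟩
  rw [(hu 0 (Nat.zero_le _) k (by omega)).2, mul_div_cancel_left₀ _ (h.ne 0 (Nat.zero_le _))]
  exact main (L 0) le_rfl k (by omega)

/-- Darboux transform. -/
lemma darboux {q : ℕ} {a b c L : ℕ → ℝ} {u : ℕ → ℕ → ℝ} (h : Sys (q+1) a b c L u)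
    (ψ : ℕ → ℝ) (hψ : ψ = fun l => u 0 l / u 0 1) :
    Sys q (fun l => -(c (l+1) * ψ (l+1) / ψ (l+2) + b l * ψ (l+2) / ψ (l+1)))
      (fun l => b (l+1) * ψ (l+3) / ψ (l+2)) (fun l => c l * ψ l / ψ (l+1))
      (fun i => L (i+1) - L 0)
      (fun i l => u (i+1) (l+1) / ψ (l+1) - u (i+1) l / ψ l) := by
  have hpos : ∀ l, 1 ≤ l → l ≤ q+2 → 0 < ψ l := by
    intro l h1 h2; rw [hψ]; exact perron h l h1 h2
  have hψe : ∀ l ≤ q+1, c l * ψ l + a l * ψ (l+1) + b l * ψ (l+2) = L 0 * ψ (l+1) := by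
    intro l hl
    have e := h.eq 0 (Nat.zero_le _) l hl
    have := h.ne 0 (Nat.zero_le _)
    rw [hψ]; field_simp; linear_combination e
  have key : ∀ i ≤ q+1, ∀ l ≤ q+1,
      b l * ψ (l+2) / ψ (l+1) * (u i (l+2) / ψ (l+2) - u i (l+1) / ψ (l+1))
      - c l * ψ l / ψ (l+1) * (u i (l+1) / ψ (l+1) - u i l / ψ l)
      = (L i - L 0) * (u i (l+1) / ψ (l+1)) := by
    intro i hi l hl
    have e := h.eq i hi l hl
    have e0 := hψe l hl
    have p1 : ψ (l+1) ≠ 0 := (hpos (l+1) (by omega) (by omega)).ne'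
    have hc : c l * ψ l * (u i l / ψ l) = c l * u i l := by
      rcases Nat.eq_zero_or_pos l with rfl | hl0
      · simp [h.c0]
      · have := (hpos l hl0 (by omega)).ne'
        field_simp
    have hb : b l * ψ (l+2) * (u i (l+2) / ψ (l+2)) = b l * u i (l+2) := by
      rcases Nat.lt_or_ge l (q+1) with h1 | h1
      · have := (hpos (l+2) (by omega) (by omega)).ne'
        field_simp
      · have : l = q+1 := by omega
        rw [this, h.bq]; simp
    have hv : u i (l+1) = ψ (l+1) * (u i (l+1) / ψ (l+1)) := by field_simp
    set v := u i (l+1) / ψ (l+1)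
    set v2 := u i (l+2) / ψ (l+2)
    set v0 := u i l / ψ l
    rw [hv, ← hc, ← hb] at e
    field_simp
    linear_combination e - v * e0
  constructor
  · simp [h.c0]
  · simp [h.bq]
  · intro l h1 h2
    exact div_pos (mul_pos (h.cpos l h1 (by omega)) (hpos l h1 (by omega))) (hpos _ (by omega) (by omega))
  · intro l h1
    exact div_pos (mul_pos (h.bpos _ (by omega)) (hpos _ (by omega) (by omega))) (hpos _ (by omega) (by omega))
  · intro i j hij hj
    have := h.anti (i+1) (j+1) (by omega) (by omega)
    show L (j+1) - L 0 < L (i+1) - L 0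
    linarith
  · intro i hi hz
    have e := key (i+1) (by omega) 0 (by omega)
    simp only [zero_add, h.c0, zero_mul, zero_div, sub_zero] at e hz
    norm_num at hz
    rw [hz, mul_zero] at e
    have h1 : L (i+1) - L 0 ≠ 0 := by
      have := h.anti 0 (i+1) (by omega) (by omega); linarith
    have h2 := h.ne (i+1) (by omega)
    have h3 := (hpos 1 le_rfl (by omega)).ne'
    exact (mul_ne_zero h1 (div_ne_zero h2 h3)) e.symm
  · intro i hi l hl
    have e1 := key (i+1) (by omega) l (by omega)
    have e2 := key (i+1) (by omega) (l+1) (by omega)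
    simp only [add_assoc] at e1 e2 ⊢
    norm_num at e1 e2 ⊢
    linear_combination e2 - e1

lemma rolle (W : ℕ → ℝ) (x : ℝ) : ∀ k l : ℕ, 0 ≤ x * (W (l+k+1) - W l) →
    ∃ j, l ≤ j ∧ j < l+k+1 ∧ 0 ≤ x * (W (j+1) - W j) := by
  intro k
  induction k with
  | zero => intro l h; exact ⟨l, le_rfl, by omega, h⟩
  | succ k ih =>
    intro l h
    by_cases hc : 0 ≤ x * (W (l+k+1) - W l)
    · obtain ⟨j, h1, h2, h3⟩ := ih l hc
      exact ⟨j, h1, by omega, h3⟩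
    · refine ⟨l+k+1, by omega, by omega, ?_⟩
      have : l + (k+1) + 1 = l+k+1+1 := by omega
      rw [this] at h
      nlinarith

lemma upper (n : ℕ) : ∀ (q : ℕ) (a b c L : ℕ → ℝ) (u : ℕ → ℕ → ℝ), Sys q a b c L u → n ≤ q+1 →
    ∀ (A : ℕ → ℝ), (∃ i < n, A i ≠ 0) →
    (∃ l, 1 ≤ l ∧ l ≤ q+1 ∧ ∑ i ∈ Finset.range n, A i * u i l ≠ 0) ∧
    ∀ (s : ℕ) (p : ℕ → ℕ) (ε : ℝ), ε ≠ 0 → 1 ≤ p 0 → (∀ i < s, p i < p (i+1)) → p s ≤ q+1 →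
      (∀ i ≤ s, 0 ≤ ε * (-1)^i * ∑ k ∈ Finset.range n, A k * u k (p i)) → s < n := by
  induction n with
  | zero => intro q a b c L u _ _ A ⟨i, hi, _⟩; omega
  | succ n ih =>
    intro q a b c L u h hn A hA
    have hmono : ∀ (s : ℕ) (p : ℕ → ℕ), (∀ i < s, p i < p (i+1)) → ∀ i ≤ s, p 0 ≤ p i ∧ p i ≤ p s := by
      intro s p hp
      have m1 : ∀ d i, i + d ≤ s → p i ≤ p (i+d) := by
        intro d
        induction d with
        | zero => intro i _; exact le_rfl
        | succ d ihd => intro i hi; exact (ihd i (by omega)).trans (hp (i+d) (by omega)).le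
      intro i hi
      refine ⟨by simpa using m1 i 0 (by omega), ?_⟩
      have := m1 (s-i) i (by omega)
      rwa [Nat.add_sub_cancel' hi] at this
    have hpos := perron h
    have hu01 := h.ne 0 (Nat.zero_le _)
    by_cases hz : ∃ i < n, A (i+1) ≠ 0
    · obtain ⟨q, rfl⟩ : ∃ q', q = q'+1 := ⟨q-1, by obtain ⟨i, hi, _⟩ := hz; omega⟩
      let ψ : ℕ → ℝ := fun l => u 0 l / u 0 1
      have hψpos : ∀ l, 1 ≤ l → l ≤ q+2 → 0 < ψ l := hpos
      have hD := darboux h ψ rfl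
      obtain ⟨I1, I2⟩ := ih q _ _ _ _ _ hD (by omega) (fun i => A (i+1)) hz
      let V : ℕ → ℝ := fun l => ∑ k ∈ Finset.range (n+1), A k * u k l
      let W : ℕ → ℝ := fun l => V l / ψ l
      have hW : ∀ l, 1 ≤ l → l ≤ q+1 → ∑ i ∈ Finset.range n,
          A (i+1) * (u (i+1) (l+1) / ψ (l+1) - u (i+1) l / ψ l) = W (l+1) - W l := by
        intro l h1 h2
        have p1 := (hψpos l h1 (by omega)).ne'
        have p2 := (hψpos (l+1) (by omega) (by omega)).ne'
        have hc : ∀ l, ψ l ≠ 0 → u 0 l / ψ l = u 0 1 := by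
          intro l hl
          have : u 0 l = ψ l * u 0 1 := by simp only [ψ]; field_simp
          rw [this]; field_simp
        have hs : ∀ l, W l = ∑ i ∈ Finset.range n, A (i+1) * (u (i+1) l / ψ l) + A 0 * (u 0 l / ψ l) := by
          intro l
          simp only [W, V]
          rw [Finset.sum_range_succ', add_div, Finset.sum_div]
          simp only [mul_div_assoc]
        rw [hs, hs, hc _ p1, hc _ p2, add_sub_add_right_eq_sub, ← Finset.sum_sub_distrib]
        simp only [mul_sub]
      refine ⟨?_, ?_⟩
      · by_contra! hall
        obtain ⟨l, h1, h2, h3⟩ := I1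
        apply h3
        rw [hW l h1 h2]
        simp only [W, V, hall l h1 (by omega), hall (l+1) (by omega) (by omega)]
        simp
      · intro s p ε hε hp0 hp hps hV
        rcases s with _ | s
        · omega
        have hb := hmono _ p hp
        have hWp : ∀ i ≤ s+1, 0 ≤ ε * (-1)^i * W (p i) := by
          intro i hi
          have := hV i hi
          have h2 := hψpos (p i) (by have := hb i hi; omega) (by have := hb i hi; omega)
          simp only [W, V]
          rw [← mul_div_assoc]
          exact div_nonneg this h2.le
        have hex : ∀ i, ∃ j, i ≤ s → p i ≤ j ∧ j < p (i+1) ∧ 0 ≤ (-ε) * (-1)^i * (W (j+1) - W j) := by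
          intro i
          by_cases hi : i ≤ s
          · have hlt := hp i (by omega)
            have e : p (i+1) = p i + (p (i+1) - p i - 1) + 1 := by omega
            obtain ⟨j, h1, h2, h3⟩ := rolle W (-ε * (-1)^i) (p (i+1) - p i - 1) (p i) (by
              rw [← e]
              have w1 := hWp i (by omega)
              have w2 := hWp (i+1) (by omega)
              rw [pow_succ] at w2
              nlinarith)
            exact ⟨j, fun _ => ⟨h1, by omega, h3⟩⟩
          · exact ⟨0, fun h => absurd h hi⟩
        choose r hr using hex
        have hsn := I2 s r (-ε) (neg_ne_zero.2 hε) (by have := hr 0 (by omega); omega)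
          (by
            intro i hi
            have h1 := hr i (by omega)
            have h2 := hr (i+1) (by omega)
            omega)
          (by have := hr s le_rfl; omega)
          (by
            intro i hi
            have h1 := hr i hi
            have h2 := hb i (by omega)
            have h3 := hb (i+1) (by omega)
            rw [hW (r i) (by omega) (by omega)]
            exact h1.2.2)
        omega
    · push Not at hz
      have hVe : ∀ l, ∑ i ∈ Finset.range (n+1), A i * u i l = A 0 * u 0 l := by
        intro l
        rw [Finset.sum_range_succ', Finset.sum_eq_zero, zero_add]
        intro i hi
        rw [hz i (Finset.mem_range.1 hi), zero_mul]
      have hA0 : A 0 ≠ 0 := by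
        obtain ⟨i, hi, hne⟩ := hA
        rcases i with _ | i
        · exact hne
        · exact absurd (hz i (by omega)) hne
      simp only [hVe]
      refine ⟨⟨1, le_rfl, by omega, mul_ne_zero hA0 hu01⟩, ?_⟩
      intro s p ε hε hp0 hp hps hV
      by_contra hs
      have hs : 1 ≤ s := by omega
      have hb := hmono s p hp
      have b1 := hb 1 hs
      have P0 := hpos (p 0) hp0 (by omega)
      have P1 := hpos (p 1) (by omega) (by omega)
      have e : ∀ l, A 0 * u 0 l = (A 0 * u 0 1) * (u 0 l / u 0 1) := by
        intro l; field_simp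
      have v0 := hV 0 (by omega)
      have v1 := hV 1 hs
      rw [e] at v0 v1
      have hne : ε * (A 0 * u 0 1) ≠ 0 := mul_ne_zero hε (mul_ne_zero hA0 hu01)
      set x := u 0 (p 0) / u 0 1
      set y := u 0 (p 1) / u 0 1
      have w0 : 0 ≤ (ε * (A 0 * u 0 1)) * x := by linarith
      have w1 : (ε * (A 0 * u 0 1)) * y ≤ 0 := by linarith
      have := nonneg_of_mul_nonneg_left w0 P0
      have := nonpos_of_mul_nonpos_left w1 P1
      exact hne (by linarith)

lemma sc_fin (q : ℕ) (g : ℕ → ℝ) : {ν : ℕ | 1 ≤ ν ∧ ν ≤ q ∧ g (ν - 1) * g ν < 0}.Finite :=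
  (Set.finite_Iic q).subset fun _ h => h.2.1

lemma sc_zero (g : ℕ → ℝ) : signChanges 0 g = 0 := by
  have : {ν : ℕ | 1 ≤ ν ∧ ν ≤ 0 ∧ g (ν - 1) * g ν < 0} = ∅ := by
    ext x; simp only [Set.mem_ofPred_eq, Set.mem_empty_iff_false, iff_false]; omega
  rw [signChanges, this, Set.ncard_empty]

lemma sc_succ_pos (q : ℕ) (g : ℕ → ℝ) (h : g q * g (q+1) < 0) :
    signChanges (q+1) g = signChanges q g + 1 := by
  have : {ν : ℕ | 1 ≤ ν ∧ ν ≤ q+1 ∧ g (ν - 1) * g ν < 0} =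
      insert (q+1) {ν : ℕ | 1 ≤ ν ∧ ν ≤ q ∧ g (ν - 1) * g ν < 0} := by
    ext x
    simp only [Set.mem_ofPred_eq, Set.mem_insert_iff]
    constructor
    · rintro ⟨h1, h2, h3⟩
      by_cases hx : x = q+1
      · exact Or.inl hx
      · exact Or.inr ⟨h1, by omega, h3⟩
    · rintro (rfl | ⟨h1, h2, h3⟩)
      · exact ⟨by omega, le_rfl, h⟩
      · exact ⟨h1, by omega, h3⟩
  rw [signChanges, this, Set.ncard_insert_of_notMem _ (sc_fin q g), signChanges]
  simp

lemma sc_succ_neg (q : ℕ) (g : ℕ → ℝ) (h : ¬ g q * g (q+1) < 0) :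
    signChanges (q+1) g = signChanges q g := by
  have : {ν : ℕ | 1 ≤ ν ∧ ν ≤ q+1 ∧ g (ν - 1) * g ν < 0} =
      {ν : ℕ | 1 ≤ ν ∧ ν ≤ q ∧ g (ν - 1) * g ν < 0} := by
    ext x
    simp only [Set.mem_ofPred_eq]
    constructor
    · rintro ⟨h1, h2, h3⟩
      by_cases hx : x = q+1
      · subst hx; exact absurd h3 h
      · exact ⟨h1, by omega, h3⟩
    · rintro ⟨h1, h2, h3⟩
      exact ⟨h1, by omega, h3⟩
  rw [signChanges, this, signChanges]

lemma sc_le (q : ℕ) (g : ℕ → ℝ) : signChanges q g ≤ q := by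
  induction q with
  | zero => rw [sc_zero]
  | succ q ih =>
    by_cases h : g q * g (q+1) < 0
    · rw [sc_succ_pos q g h]; omega
    · rw [sc_succ_neg q g h]; omega

lemma sc_flip (q : ℕ) (g : ℕ → ℝ) (hg : ∀ ν ≤ q, g ν ≠ 0) :
    signChanges q g + signChanges q (fun ν => (-1)^ν * g ν) = q := by
  induction q with
  | zero => rw [sc_zero, sc_zero]
  | succ q ih =>
    have ih := ih fun ν h => hg ν (by omega)
    have hne : g q * g (q+1) ≠ 0 := mul_ne_zero (hg q (by omega)) (hg _ le_rfl)
    have e : (-1 : ℝ)^q * g q * ((-1)^(q+1) * g (q+1)) = - (g q * g (q+1)) := by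
      have : (-1 : ℝ)^q * (-1)^q = 1 := by rw [← mul_pow]; simp
      rw [pow_succ]; linear_combination (- g q * g (q+1)) * this
    by_cases h : g q * g (q+1) < 0
    · rw [sc_succ_pos q g h, sc_succ_neg q (fun ν => (-1)^ν * g ν) (by simp only [e]; linarith)]
      omega
    · have : 0 < g q * g (q+1) := lt_of_le_of_ne (not_lt.1 h) hne.symm
      rw [sc_succ_neg q g h, sc_succ_pos q (fun ν => (-1)^ν * g ν) (by simp only [e]; linarith)]
      omega

lemma sc_points (g : ℕ → ℝ) (Q : ℕ) (hg : ∀ ν ≤ Q, g ν ≠ 0) :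
    ∃ p : ℕ → ℕ, (∀ i < signChanges Q g, p i < p (i+1)) ∧ p (signChanges Q g) ≤ Q ∧
      (∀ i ≤ signChanges Q g, 0 < g 0 * (-1)^i * g (p i)) ∧ 
      0 < g 0 * (-1)^(signChanges Q g) * g Q := by
  induction Q with
  | zero =>
    have : 0 < g 0 * g 0 := mul_self_pos.2 (hg 0 le_rfl)
    refine ⟨fun _ => 0, ?_, ?_, ?_, ?_⟩
    · rw [sc_zero]; intro i hi; omega
    · exact le_rfl
    · rw [sc_zero]; intro i hi; obtain rfl : i = 0 := by omega
      simpa using this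
    · rw [sc_zero]; simpa using this
  | succ Q ih =>
    obtain ⟨p, h1, h2, h3, h4⟩ := ih fun ν h => hg ν (by omega)
    have hQ := hg Q (by omega)
    have hne : g Q * g (Q+1) ≠ 0 := mul_ne_zero hQ (hg _ le_rfl)
    by_cases h : g Q * g (Q+1) < 0
    · have e := sc_succ_pos Q g h
      rw [e]
      set s := signChanges Q g
      have h5 : 0 < g 0 * (-1)^(s+1) * g (Q+1) := by
        have : 0 < (g 0 * (-1)^(s+1) * g (Q+1)) * (g Q * g Q) := by
          rw [pow_succ]; nlinarith
        exact pos_of_mul_pos_left this (mul_self_nonneg _)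
      refine ⟨fun i => if i ≤ s then p i else Q+1, ?_, ?_, ?_, h5⟩
      · intro i hi
        rcases Nat.lt_or_ge i s with hh | hh
        · simp only; rw [if_pos (by omega), if_pos (by omega)]; exact h1 i hh
        · obtain rfl : i = s := by omega
          beta_reduce; rw [if_pos le_rfl, if_neg (by omega)]; omega
      · simp
      · intro i hi
        by_cases hh : i ≤ s
        · simp only; rw [if_pos hh]; exact h3 i hh
        · obtain rfl : i = s+1 := by omega
          beta_reduce; rw [if_neg hh]; exact h5
    · rw [sc_succ_neg Q g h]
      have hp : 0 < g Q * g (Q+1) := lt_of_le_of_ne (not_lt.1 h) hne.symm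
      refine ⟨p, h1, by omega, h3, ?_⟩
      set s := signChanges Q g
      have : 0 < (g 0 * (-1)^s * g (Q+1)) * (g Q * g Q) := by nlinarith
      exact pos_of_mul_pos_left this (mul_self_nonneg _)

lemma upper_adm {q : ℕ} {a b c L : ℕ → ℝ} {u : ℕ → ℕ → ℝ} (h : Sys q a b c L u) (n : ℕ)
    (hn : n ≤ q+1) (A : ℕ → ℝ) (hA : ∃ i < n, A i ≠ 0) (V g : ℕ → ℝ)
    (hV : ∀ l ≤ q, V l = ∑ i ∈ Finset.range n, A i * u i (l+1)) (hg : Admissible q V g) :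
    signChanges q g < n := by
  obtain ⟨p, h1, h2, h3, -⟩ := sc_points g q hg.1
  have hmono : ∀ d i, i + d ≤ signChanges q g → p i ≤ p (i+d) := by
    intro d
    induction d with
    | zero => intro i _; exact le_rfl
    | succ d ihd => intro i hi; exact (ihd i (by omega)).trans (h1 (i+d) (by omega)).le
  refine (upper n q a b c L u h hn A hA).2 (signChanges q g) (fun i => p i + 1) (g 0)
    (hg.1 0 (Nat.zero_le _)) (by omega) ?_ (by omega) ?_
  · intro i hi; have := h1 i hi; omega
  · intro i hi
    have hpq : p i ≤ q := by
      have := hmono (signChanges q g - i) i (by omega)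
      rw [Nat.add_sub_cancel' hi] at this; omega
    rw [← hV _ hpq]
    by_cases hz : V (p i) = 0
    · rw [hz]; simp
    · rw [← hg.2 _ hpq hz]; exact (h3 i hi).le

lemma sys_flip {q : ℕ} {a b c L : ℕ → ℝ} {u : ℕ → ℕ → ℝ} (h : Sys q a b c L u) :
    Sys q (fun l => - a l) b c (fun i => - L (q - i)) (fun i l => (-1)^(l+1) * u (q-i) l) := by
  constructor
  · exact h.c0
  · exact h.bq
  · exact h.cpos
  · exact h.bpos
  · intro i j hij hj
    have := h.anti (q-j) (q-i) (by omega) (by omega)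
    simpa using this
  · intro i hi
    simpa using h.ne (q-i) (by omega)
  · intro i hi l hl
    have e := h.eq (q-i) (by omega) l hl
    simp only [pow_succ]
    linear_combination (-(-1)^l) * e

lemma Sminus_le_N (q : ℕ) (f : ℕ → ℝ) : Sminus q f ≤ N q f := by
  classical
  let t : ℕ → ℝ := fun j => Nat.rec (if f q = 0 then 1 else f q)
    (fun j r => if f (q-(j+1)) = 0 then r else f (q-(j+1))) j
  have t0 : t 0 = if f q = 0 then 1 else f q := rfl
  have ts : ∀ j, t (j+1) = if f (q-(j+1)) = 0 then t j else f (q-(j+1)) := fun _ => rfl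
  have tne : ∀ j, t j ≠ 0 := by
    intro j
    induction j with
    | zero => rw [t0]; split_ifs with h; exacts [one_ne_zero, h]
    | succ j ih => rw [ts]; split_ifs with h; exacts [ih, h]
  have tf : ∀ j, f (q-j) ≠ 0 → t j = f (q-j) := by
    intro j hj
    cases j with
    | zero => rw [t0]; simp only [Nat.sub_zero] at hj ⊢; rw [if_neg hj]
    | succ j => rw [ts, if_neg hj]
  let g : ℕ → ℝ := fun ν => t (q-ν)
  have hg : Admissible q f g := by
    refine ⟨fun ν _ => tne _, fun ν hν h => ?_⟩
    have := tf (q-ν) (by rwa [Nat.sub_sub_self hν])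
    rwa [Nat.sub_sub_self hν] at this
  have hle : Sminus q f ≤ signChanges q g :=
    Nat.sInf_le (show signChanges q g ∈ {s | ∃ g, Admissible q f g ∧ signChanges q g = s} from ⟨g, hg, rfl⟩)
  refine hle.trans ?_
  refine Set.ncard_le_ncard ?_ ((Set.finite_Iic q).subset ?_)
  · rintro ν ⟨h1, h2, h3⟩
    by_cases h0 : f ν = 0
    · exact Or.inl ⟨h2, h0⟩
    · by_cases h4 : f (ν-1) = 0
      · exfalso
        have : g (ν-1) = g ν := by
          have e : q - (ν-1) = (q-ν)+1 := by omega
          simp only [g]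
          rw [e, ts, if_pos]
          have : q - (q - ν + 1) = ν-1 := by omega
          rw [this, h4]
        rw [this] at h3
        nlinarith
      · rw [hg.2 _ h2 h0, hg.2 _ (by omega) h4] at h3
        exact Or.inr ⟨h1, h2, h3⟩
  · rintro ν (h | h)
    · exact h.1
    · exact h.2.1

lemma Splus_bdd (q : ℕ) (f : ℕ → ℝ) : BddAbove {s | ∃ g, Admissible q f g ∧ signChanges q g = s} :=
  ⟨q, by rintro s ⟨g, -, rfl⟩; exact sc_le q g⟩

lemma N_le_Splus (q : ℕ) (f : ℕ → ℝ) (hf : ∃ ν ≤ q, f ν ≠ 0) : N q f ≤ Splus q f := by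
  classical
  have hf' : ∃ ν, ν ≤ q ∧ f ν ≠ 0 := hf
  obtain ⟨j, ⟨hjq, hj⟩, hmin⟩ : ∃ j, (j ≤ q ∧ f j ≠ 0) ∧ ∀ i < j, f i = 0 := by
    refine ⟨Nat.find hf', Nat.find_spec hf', fun i hi => ?_⟩
    have h1 := Nat.find_min hf' hi
    have h2 := (Nat.find_spec hf').1
    by_contra h3
    exact h1 ⟨by omega, h3⟩
  let g : ℕ → ℝ := fun ν => Nat.rec ((-1)^j * f j)
    (fun ν r => if f (ν+1) = 0 then -r else f (ν+1)) ν
  have g0 : g 0 = (-1)^j * f j := rfl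
  have gs : ∀ ν, g (ν+1) = if f (ν+1) = 0 then - g ν else f (ν+1) := fun _ => rfl
  have gne : ∀ ν, g ν ≠ 0 := by
    intro ν
    induction ν with
    | zero => rw [g0]; exact mul_ne_zero (by simp) hj
    | succ ν ih => rw [gs]; split_ifs with h; exacts [neg_ne_zero.2 ih, h]
  have gf : ∀ ν, f ν ≠ 0 → g ν = f ν := by
    intro ν hν
    cases ν with
    | zero =>
      have : j = 0 := by
        by_contra h
        exact hν (hmin 0 (by omega))
      rw [g0, this]; simp
    | succ ν => rw [gs, if_neg hν]
  have glt : ∀ ν, ν < j → g ν = (-1)^ν * ((-1)^j * f j) := by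
    intro ν
    induction ν with
    | zero => intro _; rw [g0]; simp
    | succ ν ih => intro h; rw [gs, if_pos (hmin _ h), ih (by omega), pow_succ]; ring
  have hg : Admissible q f g := ⟨fun ν _ => gne ν, fun ν _ h => gf ν h⟩
  refine le_trans ?_ (le_csSup (Splus_bdd q f) ⟨g, hg, rfl⟩)
  have hnj : ¬ IsZero q f j := by
    rintro (h | h)
    · exact hj h.2
    · rw [hmin (j-1) (by omega)] at h; simp at h
  refine Set.ncard_le_ncard_of_injOn (fun ν => if ν < j then ν+1 else ν) ?_ ?_ (sc_fin q g)
  · intro ν hν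
    have hν : IsZero q f ν := hν
    have hneq : ν ≠ j := by rintro rfl; exact hnj hν
    have hνq : ν ≤ q := by rcases hν with h | h; exacts [h.1, h.2.1]
    by_cases hlt : ν < j
    · try simp only
      rw [if_pos hlt]
      refine ⟨by omega, by omega, ?_⟩
      have : g (ν+1) = - g ν := by
        rcases Nat.lt_or_ge (ν+1) j with h | h
        · rw [gs, if_pos (hmin _ h)]
        · obtain rfl : j = ν+1 := by omega
          rw [gf _ hj, glt ν hlt]
          have e : (-1 : ℝ)^ν * (-1)^ν = 1 := by rw [← mul_pow]; simp
          rw [pow_succ]; linear_combination (- f (ν+1)) * e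
      rw [Nat.add_sub_cancel, this]
      nlinarith [mul_self_pos.2 (gne ν)]
    · try simp only
      rw [if_neg hlt]
      refine ⟨by omega, hνq, ?_⟩
      rcases hν with h | h
      · obtain ⟨k, rfl⟩ : ∃ k, ν = k+1 := ⟨ν-1, by omega⟩
        rw [Nat.add_sub_cancel, gs, if_pos h.2]
        nlinarith [mul_self_pos.2 (gne k)]
      · have h3 := h.2.2
        rw [gf ν (by rintro e; rw [e] at h3; simp at h3),
          gf (ν-1) (by rintro e; rw [e] at h3; simp at h3)]
        exact h3
  · intro x hx y hy hxy
    have hx : x ≠ j := by rintro rfl; exact hnj hx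
    have hy : y ≠ j := by rintro rfl; exact hnj hy
    simp only at hxy
    split_ifs at hxy <;> omega

lemma sys_of_rec {α β γ ρ : ℕ → ℝ} {P : ℕ → Polynomial ℝ}
    (hP : Recurrence α β γ ρ P) {q : ℕ} {η : ℝ} {Λ : ℕ → ℝ} (hΛ : SLZeros P q η Λ) :
    Sys q (fun l => if l < q then α l / ρ l else (α l + β l * η) / ρ l)
      (fun l => if l < q then β l / ρ l else 0)
      (fun l => if l = 0 then 0 else γ (l-1) / ρ l) Λ
      (fun i l => (P (l-1)).eval (Λ i)) := by
  constructor
  · simp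
  · simp
  · intro l h1 h2
    rw [if_neg (by omega)]; exact div_pos (hP.hγ _) (hP.hρ _)
  · intro l h
    rw [if_pos h]; exact div_pos (hP.hβ _) (hP.hρ _)
  · intro i j hij hj
    exact hΛ.anti (show i ≤ q by omega) (show j ≤ q from hj) hij
  · intro i hi
    simp [hP.hP0]
  · intro i hi l hl
    have hρ := (hP.hρ l).ne'
    have e : (if l = 0 then 0 else γ (l-1)) * (P (l-1)).eval (Λ i) + α l * (P l).eval (Λ i)
        + β l * (P (l+1)).eval (Λ i) = Λ i * (ρ l * (P l).eval (Λ i)) := by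
      cases l with
      | zero =>
        have := congrArg (Polynomial.eval (Λ i)) hP.hrec0
        simpa using this
      | succ l =>
        have := congrArg (Polynomial.eval (Λ i)) (hP.hrec l)
        simpa using this
    have e2 : (if l = 0 then 0 else γ (l-1) / ρ l) = (if l = 0 then 0 else γ (l-1)) / ρ l := by
      split_ifs <;> simp
    simp only [Nat.add_sub_cancel, show l + 2 - 1 = l+1 by omega]
    rw [e2]
    generalize (if l = 0 then 0 else γ (l-1)) = G at e ⊢
    rcases Nat.lt_or_ge l q with h | h
    · rw [if_pos h, if_pos h]
      field_simp
      linear_combination e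
    · obtain rfl : l = q := by omega
      rw [if_neg (lt_irrefl l), if_neg (lt_irrefl l)]
      have r := hΛ.root i hi
      simp only [Polynomial.eval_sub, Polynomial.eval_mul, Polynomial.eval_C] at r
      field_simp
      linear_combination e - β l * r

/-- discrete Sturm oscillation theorem: for `1 ≤ m ≤ n ≤ q+1`, every
nontrivial `V(ν) = Σ_{k=m}^{n} a_k ψ_k(ν)` with `ψ_k(ν) = P_ν(λ_k)` satisfies
`m - 1 ≤ S⁻(V) ≤ N(V) ≤ S⁺(V) ≤ n - 1`. -/
theorem stmt_9 (α β γ ρ : ℕ → ℝ) (P : ℕ → Polynomial ℝ)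
    (hP : Recurrence α β γ ρ P)
    (q : ℕ) (η : ℝ) (Λ : ℕ → ℝ) (hΛ : SLZeros P q η Λ)
    (m n : ℕ) (hm : 1 ≤ m) (hmn : m ≤ n) (hn : n ≤ q + 1)
    (a : ℕ → ℝ) (ha : ∃ k ∈ Finset.Icc m n, a k ≠ 0)
    (V : ℕ → ℝ)
    (hV : ∀ ν, V ν = ∑ k ∈ Finset.Icc m n, a k * (P ν).eval (Λ (k - 1))) :
    m - 1 ≤ Sminus q V ∧ Sminus q V ≤ N q V ∧ N q V ≤ Splus q V ∧
      Splus q V ≤ n - 1 := by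
  have hS := sys_of_rec hP hΛ
  obtain ⟨k0, hk0, hak0⟩ := ha
  rw [Finset.mem_Icc] at hk0
  -- coefficients indexed from zero
  let A : ℕ → ℝ := fun i => if m ≤ i + 1 ∧ i + 1 ≤ n then a (i+1) else 0
  have hgen : ∀ F : ℕ → ℝ, ∑ k ∈ Finset.Icc m n, a k * F (k-1) =
      ∑ i ∈ Finset.range n, A i * F i := by
    intro F
    have e : ∑ k ∈ Finset.Ico 1 (n+1), A (k-1) * F (k-1) = ∑ i ∈ Finset.range n, A i * F i := by
      rw [Finset.sum_Ico_eq_sum_range]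
      simp
    rw [← e]
    apply Finset.sum_subset_zero_on_sdiff
    · intro k hk
      simp only [Finset.mem_Icc, Finset.mem_Ico] at hk ⊢
      omega
    · intro k hk
      simp only [Finset.mem_sdiff, Finset.mem_Icc, Finset.mem_Ico] at hk
      simp only [A]
      rw [if_neg (by omega), zero_mul]
    · intro k hk
      simp only [Finset.mem_Icc] at hk
      simp only [A]
      rw [if_pos (by omega), Nat.sub_add_cancel (by omega)]
  have hA : ∃ i < n, A i ≠ 0 := by
    refine ⟨k0 - 1, by omega, ?_⟩
    simp only [A]
    rw [if_pos (by omega), Nat.sub_add_cancel (by omega)]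
    exact hak0
  have hV1 : ∀ l ≤ q, V l = ∑ i ∈ Finset.range n, A i * (P (l+1-1)).eval (Λ i) := by
    intro l _
    rw [hV, Nat.add_sub_cancel, hgen (fun i => (P l).eval (Λ i))]
  have hup : ∀ g, Admissible q V g → signChanges q g < n := fun g hg =>
    upper_adm hS n hn A hA V g hV1 hg
  have hne : ∃ ν ≤ q, V ν ≠ 0 := by
    obtain ⟨l, h1, h2, h3⟩ := (upper n q _ _ _ _ _ hS hn A hA).1
    refine ⟨l-1, by omega, ?_⟩
    rw [hV1 _ (by omega), Nat.add_sub_cancel]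
    exact h3
  have hadm : ∃ g, Admissible q V g := by
    classical
    refine ⟨fun ν => if V ν = 0 then 1 else V ν, ?_, ?_⟩
    · intro ν _
      simp only
      split_ifs with h
      exacts [one_ne_zero, h]
    · intro ν _ h
      simp only
      rw [if_neg h]
  refine ⟨?_, Sminus_le_N q V, N_le_Splus q V hne, ?_⟩
  · obtain ⟨g1, hg1⟩ := hadm
    obtain ⟨g, hg, hgs⟩ := Nat.sInf_mem (s := {s | ∃ g, Admissible q V g ∧ signChanges q g = s})
      ⟨_, g1, hg1, rfl⟩
    have hgs : signChanges q g = Sminus q V := hgs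
    rw [← hgs]
    have hfl := sc_flip q g hg.1
    have hlt : signChanges q (fun ν => (-1)^ν * g ν) < q + 2 - m := by
      refine upper_adm (sys_flip hS) (q+2-m) (by omega) (fun i => if i ≤ q ∧ q - i < n then A (q-i) else 0) ?_
        (fun ν => (-1)^ν * V ν) _ ?_ ?_
      · refine ⟨q - (k0 - 1), by omega, ?_⟩
        simp only [A]
        have e : q - (q - (k0-1)) = k0 - 1 := by omega
        rw [e, if_pos (by omega), if_pos (by omega), Nat.sub_add_cancel (by omega)]
        exact hak0
      · intro l hl
        rw [hV1 l hl, Finset.mul_sum]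
        simp only [Nat.add_sub_cancel]
        have hz : ∀ i, i < n → ¬ (m ≤ i+1) → A i = 0 := by
          intro i hi hmi; simp only [A]; rw [if_neg (by omega)]
        have e1 : ∑ i ∈ Finset.range (q+1), (if i < n then (-1)^l * (A i * (P l).eval (Λ i)) else 0)
            = ∑ i ∈ Finset.range n, (-1)^l * (A i * (P l).eval (Λ i)) := by
          rw [← Finset.sum_filter]
          apply Finset.sum_congr _ fun _ _ => rfl
          ext i; simp only [Finset.mem_filter, Finset.mem_range]; omega
        rw [← e1, ← Finset.sum_range_reflect]
        symm
        apply Finset.sum_subset_zero_on_sdiff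
        · intro i hi; simp only [Finset.mem_range] at hi ⊢; omega
        · intro i hi
          simp only [Finset.mem_sdiff, Finset.mem_range] at hi
          split_ifs with h
          · rw [hz _ h (by omega)]; simp
          · rfl
        · intro i hi
          simp only [Finset.mem_range] at hi
          have e2 : q + 1 - 1 - i = q - i := by omega
          rw [e2]
          by_cases h : q - i < n
          · rw [if_pos h, if_pos (by omega)]
            rw [show l+1+1 = l+2 by omega, pow_add]; ring
          · rw [if_neg h, if_neg (by omega)]; simp
      · refine ⟨fun ν hν => mul_ne_zero (by simp) (hg.1 ν hν), fun ν hν h => ?_⟩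
        simp only at h ⊢
        rw [hg.2 ν hν (right_ne_zero_of_mul h)]
    omega
  · refine csSup_le' ?_
    rintro s ⟨g, hg, rfl⟩
    have := hup g hg
    omega

end DiscPaper
end

section
/- Let ψ_k(ν) = P_ν(λ_k) be as in the discrete Sturm–Liouville problem. Then for every n ∈ {1,…,q+1}, the functions ψ_1,…,ψ_n form a T_Z-system on [0,q]_Z, i.e., every nontrivial linear combination p(ν) = Σ_{k=1}^{n} a_k ψ_k(ν) satisfies N(p) ≤ n − 1. -/
namespace DiscPaper

/-- zero at position `i+1` -/
def ZZ (f : ℕ → ℝ) (i : ℕ) : Prop := f (i + 1) = 0 ∨ f i * f (i + 1) < 0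

open Classical in
noncomputable def cnt (m : ℕ) (f : ℕ → ℝ) : ℕ := ∑ i ∈ Finset.range m, if ZZ f i then 1 else 0

open Classical in
lemma cnt_succ (m : ℕ) (f : ℕ → ℝ) : cnt (m + 1) f = cnt m f + if ZZ f m then 1 else 0 := by
  rw [cnt, cnt, Finset.sum_range_succ]

lemma rolle_aux (G1 G2 H0 H1 : ℝ) (hpos : G1 < G2 → 0 < H1) (hneg : G2 < G1 → H1 < 0)
    (hz : G2 = G1 → H1 = 0) :
    ((G2 = 0 ∨ G1 * G2 < 0) → (G1 = 0 ∨ 0 < G1 * H0) → (H1 = 0 ∨ H0 * H1 < 0)) ∧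
    ((G2 = 0 ∨ G1 * G2 < 0) → (G2 = 0 ∨ 0 < G2 * H1)) ∧
    (¬ (G2 = 0 ∨ G1 * G2 < 0) → (G1 = 0 ∨ 0 < G1 * H0) → ¬ (H1 = 0 ∨ H0 * H1 < 0) →
      (G2 = 0 ∨ 0 < G2 * H1)) := by
  simp only [mul_pos_iff, mul_neg_iff]
  refine ⟨?_, ?_, ?_⟩ <;> grind

lemma rolle_s10 (g h d : ℕ → ℝ) (m : ℕ) (hd : ∀ i, 0 < d i) (hg0 : g 0 = 0)
    (hh : ∀ i, 1 ≤ i → i ≤ m → h i = d i * (g (i + 1) - g i)) :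
    ∀ j, j ≤ m → (cnt (j + 1) g ≤ cnt j h ∨
      (cnt (j + 1) g = cnt j h + 1 ∧ (g (j + 1) = 0 ∨ 0 < g (j + 1) * h j))) := by
  classical
  intro j
  induction j with
  | zero =>
    intro _
    simp only [cnt, ZZ]
    by_cases h1 : g 1 = 0 <;> simp [h1, hg0]
  | succ j ih =>
    intro hj
    have ih := ih (by omega)
    rw [cnt_succ (j + 1) g, cnt_succ j h]
    have e := hh (j + 1) (by omega) hj
    have hdj := hd (j + 1)
    have hpos : g (j+1) < g (j+1+1) → 0 < h (j+1) := fun H => by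
      rw [e]; exact mul_pos hdj (by linarith)
    have hneg : g (j+1+1) < g (j+1) → h (j+1) < 0 := fun H => by
      rw [e]; exact mul_neg_of_pos_of_neg hdj (by linarith)
    have hz : g (j+1+1) = g (j+1) → h (j+1) = 0 := fun H => by rw [e, H]; ring
    have hz2 : h (j+1) = 0 → g (j+1+1) = g (j+1) := fun H => by
      rw [e] at H
      rcases mul_eq_zero.1 H with H | H <;> linarith
    obtain ⟨k1, k2, k3⟩ := rolle_aux (g (j+1)) (g (j+1+1)) (h j) (h (j+1)) hpos hneg hz
    unfold ZZ
    by_cases hA : g (j+1+1) = 0 ∨ g (j+1) * g (j+1+1) < 0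
    all_goals by_cases hB : h (j+1) = 0 ∨ h j * h (j+1) < 0
    all_goals simp only [hA, hB, if_true, if_false]
    · rcases ih with ih | ⟨ih, ih'⟩
      · left; omega
      · right; exact ⟨by omega, k2 hA⟩
    · rcases ih with ih | ⟨ih, ih'⟩
      · by_cases hh : cnt (j + 1) g = cnt j h
        · right; exact ⟨by omega, k2 hA⟩
        · left; omega
      · exact absurd (k1 hA ih') hB
    · left; omega
    · rcases ih with ih | ⟨ih, ih'⟩
      · left; omega
      · right; exact ⟨by omega, k3 hA ih' hB⟩

open Polynomial in
/-- polynomial solution of the symmetric recurrence -/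
noncomputable def U (c a r : ℕ → ℝ) : ℕ → ℝ[X]
  | 0 => 0
  | 1 => 1
  | (i + 2) => C (c (i+1))⁻¹ * ((C (r (i+1)) * X - C (a (i+1))) * U c a r (i+1) - C (c i) * U c a r i)

open Polynomial in
lemma U_deg (c a r : ℕ → ℝ) : ∀ i, (U c a r i).natDegree ≤ i - 1 ∧ (U c a r (i+1)).natDegree ≤ i := by
  intro i
  induction i with
  | zero => simp [U]
  | succ i ih =>
    refine ⟨by simpa using ih.2, ?_⟩
    rw [U]
    refine (natDegree_C_mul_le _ _).trans ?_
    refine (natDegree_sub_le _ _).trans (max_le ?_ ?_)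
    · refine natDegree_mul_le.trans ?_
      have : (C (r (i+1)) * X - C (a (i+1))).natDegree ≤ 1 := by compute_degree
      have := ih.2
      omega
    · refine (natDegree_C_mul_le _ _).trans ?_
      have := ih.1
      omega

lemma U_rec (c a r : ℕ → ℝ) (hc : ∀ i, 0 < c i) (x : ℝ) (i : ℕ) :
    c i * (U c a r i).eval x + a (i+1) * (U c a r (i+1)).eval x
      + c (i+1) * (U c a r (i+2)).eval x = x * r (i+1) * (U c a r (i+1)).eval x := by
  have := (hc (i+1)).ne'
  rw [U]
  simp
  field_simp
  ring

lemma U_big (c a r : ℕ → ℝ) (hc : ∀ i, 0 < c i) (hr : ∀ i, 0 < r i) (m : ℕ) :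
    ∃ M, ∀ x, M ≤ x → ∀ i, i ≤ m →
      0 ≤ (U c a r i).eval x ∧ 0 < (U c a r (i+1)).eval x ∧
      (U c a r i).eval x ≤ (U c a r (i+1)).eval x := by
  refine ⟨∑ j ∈ Finset.range m, |(c j + c (j+1) + a (j+1)) / r (j+1)|, fun x hx i => ?_⟩
  induction i with
  | zero => intro _; simp [U]
  | succ i ih =>
    intro hi
    obtain ⟨h1, h2, h3⟩ := ih (by omega)
    have hb : (c i + c (i+1) + a (i+1)) / r (i+1) ≤ x := by
      refine (le_abs_self _).trans (le_trans ?_ hx)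
      exact Finset.single_le_sum (f := fun j => |(c j + c (j+1) + a (j+1)) / r (j+1)|)
        (fun j _ => abs_nonneg _) (Finset.mem_range.2 (by omega))
    rw [div_le_iff₀ (hr _)] at hb
    have e := U_rec c a r hc x i
    have hci := hc i
    have hci1 := hc (i+1)
    have hle : (U c a r (i+1)).eval x ≤ (U c a r (i+2)).eval x := by
      refine le_of_mul_le_mul_left ?_ hci1
      have k1 := mul_le_mul_of_nonneg_right hb h2.le
      have k2 := mul_le_mul_of_nonneg_left h3 hci.le
      nlinarith
    exact ⟨h2.le, lt_of_lt_of_le h2 hle, hle⟩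

lemma perron_s10 (c a r : ℕ → ℝ) (hc : ∀ i, 0 < c i) (hr : ∀ i, 0 < r i) (m : ℕ) (hm : 1 ≤ m)
    (x : ℕ → ℝ) (hx : StrictAntiOn x (Set.Iio m))
    (hroot : ∀ k < m, (U c a r (m+1)).eval (x k) = 0) :
    ∀ i, 1 ≤ i → i ≤ m → 0 < (U c a r i).eval (x 0) := by
  obtain ⟨M, hM⟩ := U_big c a r hc hr m
  let S : Set ℝ := ⋃ i ∈ Finset.range (m+1), {y | (U c a r (i+1)).eval y ≤ 0}
  have hS : ∀ y, y ∈ S ↔ ∃ i, i ≤ m ∧ (U c a r (i+1)).eval y ≤ 0 := by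
    intro y; simp [S]
  have hcl : IsClosed S := by
    refine isClosed_biUnion_finset fun i _ => ?_
    exact isClosed_le (U c a r (i+1)).continuous continuous_const
  have hbdd : BddAbove S := by
    refine ⟨M, fun y hy => ?_⟩
    by_contra! hlt
    obtain ⟨i, hi, h⟩ := (hS y).1 hy
    exact absurd (hM y hlt.le i hi).2.1 (not_lt.2 h)
  have hx0S : x 0 ∈ S := (hS _).2 ⟨m, le_rfl, (hroot 0 (by omega)).le⟩
  set s := sSup S with hs
  have hsS : s ∈ S := hcl.csSup_mem ⟨_, hx0S⟩ hbdd
  have hgt : ∀ y, s < y → ∀ i, i ≤ m → 0 < (U c a r (i+1)).eval y := by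
    intro y hy i hi
    by_contra! h
    exact absurd (le_csSup hbdd ((hS y).2 ⟨i, hi, h⟩)) (not_le.2 hy)
  have hnn : ∀ i, i ≤ m → 0 ≤ (U c a r (i+1)).eval s := by
    intro i hi
    have ht : Filter.Tendsto (fun y => (U c a r (i+1)).eval y) (nhdsWithin s (Set.Ioi s))
        (nhds ((U c a r (i+1)).eval s)) :=
      ((U c a r (i+1)).continuous.tendsto s).mono_left nhdsWithin_le_nhds
    refine ge_of_tendsto ht ?_
    filter_upwards [self_mem_nhdsWithin] with y hy
    exact (hgt y hy i hi).le
  have hne : ∀ i, i < m → (U c a r (i+1)).eval s ≠ 0 := by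
    intro i
    induction i with
    | zero => intro _; simp [U]
    | succ i ih =>
      intro hi h0
      have e := U_rec c a r hc s (i+1)
      rw [h0] at e
      have k1 := hnn i (by omega)
      have k2 := hnn (i+2) (by omega)
      have k3 := mul_nonneg (hc (i+1+1)).le k2
      have k4 := mul_pos (hc (i+1)) (lt_of_le_of_ne k1 (ih (by omega)).symm)
      linarith
  have hpos : ∀ i, i < m → 0 < (U c a r (i+1)).eval s := fun i hi =>
    lt_of_le_of_ne (hnn i hi.le) (hne i hi).symm
  have hsroot : (U c a r (m+1)).eval s = 0 := by
    obtain ⟨i, hi, h⟩ := (hS s).1 hsS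
    rcases hi.lt_or_eq with hi | rfl
    · exact absurd (hpos i hi) (not_lt.2 h)
    · exact le_antisymm h (hnn _ le_rfl)
  have hs0 : s = x 0 := by
    by_contra hsx
    have hlt : x 0 < s := lt_of_le_of_ne (le_csSup hbdd hx0S) (Ne.symm hsx)
    have hU : U c a r (m+1) ≠ 0 := by
      intro h
      have := (hM M le_rfl m le_rfl).2.1
      rw [h] at this
      simp at this
    have hxs : ∀ k < m, x k < s := by
      intro k hk
      refine lt_of_le_of_lt ?_ hlt
      exact hx.antitoneOn (show 0 < m by omega) hk (Nat.zero_le k)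
    have hinj : Set.InjOn x (Finset.range m : Set ℕ) := by
      intro i hi j hj h
      exact hx.injOn (by simpa using hi) (by simpa using hj) h
    have hns : s ∉ (Finset.range m).image x := by
      intro h
      obtain ⟨k, hk, h⟩ := Finset.mem_image.1 h
      have := hxs k (Finset.mem_range.1 hk)
      linarith
    have hcard : (insert s ((Finset.range m).image x)).card = m + 1 := by
      rw [Finset.card_insert_of_notMem hns, Finset.card_image_of_injOn hinj, Finset.card_range]
    have hsub : (insert s ((Finset.range m).image x)).val ⊆ (U c a r (m+1)).roots := by
      intro y hy
      rw [Polynomial.mem_roots hU, Polynomial.IsRoot]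
      rcases Finset.mem_insert.1 (show y ∈ insert s ((Finset.range m).image x) from hy) with rfl | hy
      · exact hsroot
      · obtain ⟨k, hk, rfl⟩ := Finset.mem_image.1 hy
        exact hroot k (Finset.mem_range.1 hk)
    have h1 := Polynomial.card_le_degree_of_subset_roots hsub
    have h2 := (U_deg c a r m).2
    omega
  intro i h1 h2
  have := hpos (i-1) (by omega)
  rw [hs0, show i - 1 + 1 = i by omega] at this
  exact this

/-- an eigenfunction is a multiple of `U` -/
lemma eig_eq (c a r : ℕ → ℝ) (hc : ∀ i, 0 < c i) (m : ℕ) (x : ℝ) (F : ℕ → ℝ) (h0 : F 0 = 0)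
    (he : ∀ i < m, c i * F i + a (i+1) * F (i+1) + c (i+1) * F (i+2) = x * r (i+1) * F (i+1)) :
    ∀ i, i ≤ m → F i = F 1 * (U c a r i).eval x ∧ F (i+1) = F 1 * (U c a r (i+1)).eval x := by
  intro i
  induction i with
  | zero => intro _; simp [U, h0]
  | succ i ih =>
    intro hi
    obtain ⟨h1, h2⟩ := ih (by omega)
    refine ⟨h2, ?_⟩
    have e1 := he i (by omega)
    have e2 := U_rec c a r hc x i
    refine mul_left_cancel₀ (hc (i+1)).ne' ?_
    rw [h1, h2] at e1
    linear_combination e1 - F 1 * e2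

lemma cnt_div (m : ℕ) (p E : ℕ → ℝ) (hE : ∀ i, 0 < E i) : cnt m (fun i => p i / E i) = cnt m p := by
  classical
  refine Finset.sum_congr rfl fun i _ => ?_
  have : ZZ (fun i => p i / E i) i ↔ ZZ p i := by
    unfold ZZ
    have h1 := (hE (i+1))
    have h2 : p i / E i * (p (i+1) / E (i+1)) = p i * p (i+1) / (E i * E (i+1)) := by
      rw [div_mul_div_comm]
    rw [h2, div_eq_zero_iff, div_neg_iff]
    have h3 := mul_pos (hE i) h1
    constructor
    · rintro ((h | h) | h | h)
      · exact Or.inl h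
      · linarith
      · linarith [h.2]
      · exact Or.inr h.1
    · rintro (h | h)
      · exact Or.inl (Or.inl h)
      · exact Or.inr (Or.inr ⟨h, h3⟩)
  simp only [this]

lemma main_lem : ∀ (n m : ℕ) (c a r : ℕ → ℝ) (_ : ∀ i, 0 < c i) (_ : ∀ i, 0 < r i)
    (x : ℕ → ℝ) (_ : StrictAntiOn x (Set.Iio m)) (F : ℕ → ℕ → ℝ)
    (_ : ∀ k < m, F k 0 = 0) (_ : ∀ k < m, F k (m+1) = 0) (_ : ∀ k < m, F k 1 ≠ 0)
    (_ : ∀ k < m, ∀ i < m, c i * F k i + a (i+1) * F k (i+1) + c (i+1) * F k (i+2)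
      = x k * r (i+1) * F k (i+1)) (_ : n + 1 ≤ m) (b : ℕ → ℝ) (_ : ∃ k ≤ n, b k ≠ 0),
    cnt m (fun i => ∑ k ∈ Finset.range (n+1), b k * F k i) ≤ n := by
  classical
  intro n
  induction n with
  | zero =>
    intro m c a r hc hr x hx F h0 hm h1 he hn b hb
    obtain ⟨k, hk, hbk⟩ := hb
    obtain rfl : k = 0 := by omega
    have hU : ∀ k < m, (U c a r (m+1)).eval (x k) = 0 := by
      intro k hk
      have := (eig_eq c a r hc m (x k) (F k) (h0 k hk) (he k hk) m le_rfl).2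
      rw [hm k hk] at this
      exact (mul_eq_zero.1 this.symm).resolve_left (h1 k hk)
    have hpos := perron_s10 c a r hc hr m (by omega) x hx hU
    have hF := fun i hi => (eig_eq c a r hc m (x 0) (F 0) (h0 0 (by omega)) (he 0 (by omega)) i hi).1
    refine le_of_eq (Finset.sum_eq_zero fun i hi => ?_)
    have hi := Finset.mem_range.1 hi
    rw [if_neg]
    have hp1 := hpos (i+1) (by omega) (by omega)
    have hFF : F 0 1 ≠ 0 := h1 0 (by omega)
    have hge : 0 ≤ (U c a r i).eval (x 0) := by
      rcases Nat.eq_zero_or_pos i with rfl | h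
      · simp [U]
      · exact (hpos i h (by omega)).le
    simp only [ZZ, zero_add, Finset.sum_range_one]
    rw [hF (i+1) (by omega), hF i (by omega)]
    rintro (h | h)
    · have := mul_ne_zero hbk (mul_ne_zero hFF hp1.ne')
      exact this h
    · have : 0 ≤ (b 0 * F 0 1)^2 * ((U c a r i).eval (x 0) * (U c a r (i+1)).eval (x 0)) := by
        positivity
      nlinarith
  | succ n ih =>
    intro m c a r hc hr x hx F h0 hm h1 he hn b hb
    have hU : ∀ k < m, (U c a r (m+1)).eval (x k) = 0 := by
      intro k hk
      have := (eig_eq c a r hc m (x k) (F k) (h0 k hk) (he k hk) m le_rfl).2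
      rw [hm k hk] at this
      exact (mul_eq_zero.1 this.symm).resolve_left (h1 k hk)
    have hpos := perron_s10 c a r hc hr m (by omega) x hx hU
    have hF := fun i hi => (eig_eq c a r hc m (x 0) (F 0) (h0 0 (by omega)) (he 0 (by omega)) i hi).1
    obtain ⟨m, rfl⟩ : ∃ m', m = m' + 1 := ⟨m - 1, by omega⟩
    set V : ℕ → ℝ := fun i => (U c a r i).eval (x 0) with hV
    have hVrec : ∀ i, c i * V i + a (i+1) * V (i+1) + c (i+1) * V (i+2) = x 0 * r (i+1) * V (i+1) :=
      fun i => U_rec c a r hc (x 0) i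
    have hV0 : V 0 = 0 := by simp [hV, U]
    have hVm : V (m+1+1) = 0 := hU 0 (by omega)
    have hV1 : V 1 = 1 := by simp [hV, U]
    set E : ℕ → ℝ := fun i => if 1 ≤ i ∧ i ≤ m + 1 then V i else 1 with hE
    have hEV : ∀ i, 1 ≤ i → i ≤ m + 1 → E i = V i := fun i h1 h2 => if_pos ⟨h1, h2⟩
    have hEpos : ∀ i, 0 < E i := by
      intro i
      simp only [hE]
      split_ifs with h
      · exact hpos i h.1 h.2
      · exact one_pos
    by_cases hall : ∀ k, k ≤ n → b (k+1) = 0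
    · have hb0 : b 0 ≠ 0 := by
        obtain ⟨k, hk, hbk⟩ := hb
        rcases k with _ | k
        · exact hbk
        · exact absurd (hall k (by omega)) hbk
      have hz : cnt (m+1) (fun i => ∑ k ∈ Finset.range (n+1+1), b k * F k i) ≤ 0 := by
        refine le_of_eq (Finset.sum_eq_zero fun i hi => ?_)
        have hi := Finset.mem_range.1 hi
        rw [if_neg]
        have hp1 : 0 < V (i+1) := hpos (i+1) (by omega) (by omega)
        have hFF : F 0 1 ≠ 0 := h1 0 (by omega)
        have hge : 0 ≤ V i := by
          rcases Nat.eq_zero_or_pos i with rfl | h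
          · rw [hV0]
          · exact (hpos i h (by omega)).le
        have hs : ∀ i, ∑ k ∈ Finset.range (n+1+1), b k * F k i = b 0 * F 0 i := by
          intro i
          rw [Finset.sum_range_succ', Finset.sum_eq_zero, zero_add]
          intro k hk
          rw [hall k (by have := Finset.mem_range.1 hk; omega), zero_mul]
        simp only [ZZ, hs]
        rw [hF (i+1) (by omega), hF i (by omega)]
        rintro (h | h)
        · have := mul_ne_zero hb0 (mul_ne_zero hFF hp1.ne')
          exact this h
        · have : 0 ≤ (b 0 * F 0 1)^2 * (V i * V (i+1)) := by
            positivity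
          simp only [hV] at this
          nlinarith
      omega
    · push Not at hall
      set h : ℕ → ℕ → ℝ := fun k i => c i * (F (k+1) (i+1) * V i - F (k+1) i * V (i+1)) with hh
      have hD : ∀ k < m, ∀ i < m + 1,
          h k (i+1) - h k i = (x (k+1) - x 0) * (r (i+1) * F (k+1) (i+1) * V (i+1)) := by
        intro k hk i hi
        have e1 := he (k+1) (by omega) i hi
        have e2 := hVrec i
        simp only [hh]
        linear_combination V (i+1) * e1 - F (k+1) (i+1) * e2
      have hlt : ∀ k < m, x (k+1) < x 0 := fun k hk =>
        hx (show 0 < m + 1 by omega) (show k + 1 < m + 1 by omega) (by omega)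
      set c' : ℕ → ℝ := fun i => 1 / (r (i+1) * E (i+1)^2) with hc'
      have key := ih m c' (fun i => -(c' i + c' (i-1))) (fun i => 1 / (c i * E i * E (i+1)))
        (fun i => by have := hr (i+1); have := hEpos (i+1); positivity)
        (fun i => by have := hc i; have := hEpos (i+1); have := hEpos i; positivity)
        (fun k => x (k+1) - x 0)
        (fun i hi j hj hij => sub_lt_sub_right (hx (show i + 1 < m + 1 from Nat.succ_lt_succ hi)
          (show j + 1 < m + 1 from Nat.succ_lt_succ hj) (by omega)) _)
        h
        (fun k hk => by simp [hh, hV0, h0 (k+1) (by omega)])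
        (fun k hk => by simp [hh, hVm, hm (k+1) (by omega)])
        (fun k hk => by
          have e := hD k hk 0 (by omega)
          have e0 : h k 0 = 0 := by simp [hh, hV0, h0 (k+1) (by omega)]
          rw [e0, sub_zero] at e
          simp only [zero_add] at e
          rw [e, hV1, mul_one]
          exact mul_ne_zero (sub_ne_zero.2 (hlt k hk).ne)
            (mul_ne_zero (hr 1).ne' (h1 (k+1) (by omega))))
        (fun k hk i hi => by
          have e1 := hD k hk i (by omega)
          have e2 := hD k hk (i+1) (by omega)
          have p1 : 0 < V (i+1) := hpos (i+1) (by omega) (by omega)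
          have p2 : 0 < V (i+2) := hpos (i+2) (by omega) (by omega)
          have q1 := hr (i+1)
          have q2 := hr (i+2)
          have q3 := hc (i+1)
          have t1 : c' i * (h k (i+1) - h k i) = (x (k+1) - x 0) * (F (k+1) (i+1) / V (i+1)) := by
            rw [e1]
            simp only [hc', hEV (i+1) (by omega) (by omega)]
            field_simp
          have t2 : c' (i+1) * (h k (i+2) - h k (i+1))
              = (x (k+1) - x 0) * (F (k+1) (i+2) / V (i+2)) := by
            rw [e2]
            simp only [hc', hEV (i+1+1) (by omega) (by omega)]
            field_simp
          have t3 : 1 / (c (i+1) * E (i+1) * E (i+1+1)) * h k (i+1)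
              = F (k+1) (i+2) / V (i+2) - F (k+1) (i+1) / V (i+1) := by
            simp only [hh, hEV (i+1) (by omega) (by omega), hEV (i+1+1) (by omega) (by omega)]
            field_simp
          simp only [Nat.add_sub_cancel]
          linear_combination t2 - t1 - (x (k+1) - x 0) * t3)
        (by omega) (fun k => b (k+1)) hall
      have hp0 : ∑ k ∈ Finset.range (n+1+1), b k * F k 0 = 0 := by
        refine Finset.sum_eq_zero fun k hk => ?_
        rw [h0 k (by have := Finset.mem_range.1 hk; omega), mul_zero]
      have R := rolle_s10 (fun i => (∑ k ∈ Finset.range (n+1+1), b k * F k i) / E i)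
        (fun i => ∑ k ∈ Finset.range (n+1), b (k+1) * h k i)
        (fun i => c i * E i * E (i+1)) m
        (fun i => by have := hc i; have := hEpos (i+1); have := hEpos i; positivity)
        (by simp only [hp0, zero_div])
        (fun i i1 i2 => by
          have p1 : 0 < V i := hpos i (by omega) (by omega)
          have p2 : 0 < V (i+1) := hpos (i+1) (by omega) (by omega)
          have hz : F 0 (i+1) * V i - F 0 i * V (i+1) = 0 := by
            rw [hF (i+1) (by omega), hF i (by omega)]
            ring
          simp only [hEV i i1 (by omega), hEV (i+1) (by omega) (by omega)]
          have e : c i * V i * V (i+1) * ((∑ k ∈ Finset.range (n+1+1), b k * F k (i+1)) / V (i+1)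
              - (∑ k ∈ Finset.range (n+1+1), b k * F k i) / V i)
              = c i * ((∑ k ∈ Finset.range (n+1+1), b k * F k (i+1)) * V i
                - (∑ k ∈ Finset.range (n+1+1), b k * F k i) * V (i+1)) := by
            field_simp
          rw [e, Finset.sum_mul, Finset.sum_mul, ← Finset.sum_sub_distrib, Finset.mul_sum,
            Finset.sum_range_succ' _ (n+1)]
          have e0 : c i * (b 0 * F 0 (i+1) * V i - b 0 * F 0 i * V (i+1)) = 0 := by
            linear_combination c i * b 0 * hz
          rw [e0, add_zero]
          refine Finset.sum_congr rfl fun k _ => ?_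
          simp only [hh]
          ring)
        m le_rfl
      rw [cnt_div _ _ _ hEpos] at R
      omega

/-- symmetrizing weights -/
noncomputable def wt (β γ : ℕ → ℝ) : ℕ → ℝ
  | 0 => 1
  | (l + 1) => wt β γ l * β l / γ l

lemma wt_pos (β γ : ℕ → ℝ) (hβ : ∀ l, 0 < β l) (hγ : ∀ l, 0 < γ l) : ∀ l, 0 < wt β γ l
  | 0 => by simp [wt]
  | (l + 1) => by
    rw [wt]
    exact div_pos (mul_pos (wt_pos β γ hβ hγ l) (hβ l)) (hγ l)

/-- shift a sequence by one, with prescribed value at `0` -/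
def shiftSeq (z : ℝ) (f : ℕ → ℝ) : ℕ → ℝ
  | 0 => z
  | (l + 1) => f l

lemma N_eq_cnt (q : ℕ) (f p : ℕ → ℝ) (hp0 : p 0 = 0) (hp : ∀ i ≤ q, p (i+1) = f i) :
    N q f = cnt (q+1) p := by
  classical
  have : {ν : ℕ | IsZero q f ν} = ((Finset.range (q+1)).filter (fun i => ZZ p i) : Finset ℕ) := by
    ext ν
    rw [Finset.mem_coe, Finset.mem_filter, Finset.mem_range]
    simp only [Set.mem_ofPred_eq, IsZero]
    unfold ZZ
    rcases ν with _ | ν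
    · simp [hp0, hp 0 (Nat.zero_le q)]
    · by_cases h : ν + 1 ≤ q
      · rw [hp (ν+1) h, hp ν (by omega)]
        simp [h, Nat.lt_succ_iff]
      · simp [h]
  rw [N, this, Set.ncard_coe_finset, cnt, Finset.card_filter]

/-- for every `n ∈ {1,…,q+1}` the eigenfunctions `ψ_1,…,ψ_n` of the
discrete Sturm–Liouville problem form a `T_ℤ`-system on `[0,q]_ℤ`: every nontrivial
`p(ν) = Σ_{k=1}^{n} a_k ψ_k(ν)` satisfies `N(p) ≤ n - 1`. -/
theorem stmt_10 (α β γ ρ : ℕ → ℝ) (P : ℕ → Polynomial ℝ)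
    (hP : Recurrence α β γ ρ P)
    (q : ℕ) (η : ℝ) (Λ : ℕ → ℝ) (hΛ : SLZeros P q η Λ)
    (n : ℕ) (hn1 : 1 ≤ n) (hn : n ≤ q + 1) :
    ∀ a : ℕ → ℝ, (∃ k ∈ Finset.Icc 1 n, a k ≠ 0) →
      N q (fun ν => ∑ k ∈ Finset.Icc 1 n, a k * (P ν).eval (Λ (k - 1))) ≤ n - 1 := by
  rintro a ⟨k, hk, hak⟩
  obtain ⟨n, rfl⟩ : ∃ n', n = n' + 1 := ⟨n - 1, by omega⟩
  rw [Finset.mem_Icc] at hk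
  have hw := wt_pos β γ hP.hβ hP.hγ
  set w := wt β γ with hwd
  set F : ℕ → ℕ → ℝ := fun k => shiftSeq 0 (fun i => if i ≤ q then (P i).eval (Λ k) else 0) with hF
  have hF0 : ∀ k, F k 0 = 0 := fun k => rfl
  have hFs : ∀ k i, i ≤ q → F k (i+1) = (P i).eval (Λ k) := fun k i hi => if_pos hi
  have hFq : ∀ k, F k (q+1+1) = 0 := fun k => if_neg (by omega)
  have key := main_lem n (q+1) (shiftSeq 1 (fun l => w l * β l))
    (shiftSeq 0 (fun l => w l * α l + if l = q then w l * β l * η else 0))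
    (shiftSeq 1 (fun l => w l * ρ l))
    (fun i => by
      rcases i with _ | i
      · exact one_pos
      · exact mul_pos (hw i) (hP.hβ i))
    (fun i => by
      rcases i with _ | i
      · exact one_pos
      · exact mul_pos (hw i) (hP.hρ i))
    Λ (fun i hi j hj hij => hΛ.anti (Nat.lt_succ_iff.1 hi) (Nat.lt_succ_iff.1 hj) hij) F
    (fun k _ => hF0 k) (fun k _ => hFq k)
    (fun k _ => by rw [hFs k 0 (Nat.zero_le q), hP.hP0]; simp)
    (fun k hk i hi => by
      have hroot := hΛ.root k (by omega)
      simp only [Polynomial.eval_sub, Polynomial.eval_mul, Polynomial.eval_C] at hroot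
      rw [hFs k i (by omega)]
      simp only [shiftSeq]
      have hlast : w i * β i * F k (i+2) + (if i = q then w i * β i * η else 0) * (P i).eval (Λ k)
          = w i * β i * (P (i+1)).eval (Λ k) := by
        by_cases h : i = q
        · subst h
          rw [hFq, if_pos rfl]
          linear_combination -(w i * β i) * hroot
        · rw [hFs k (i+1) (by omega), if_neg h]
          ring
      rcases i with _ | i
      · have e := congrArg (Polynomial.eval (Λ k)) hP.hrec0
        simp only [Polynomial.eval_add, Polynomial.eval_mul, Polynomial.eval_C,
          Polynomial.eval_X] at e
        rw [hF0]
        linear_combination hlast + w 0 * e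
      · have e := congrArg (Polynomial.eval (Λ k)) (hP.hrec i)
        simp only [Polynomial.eval_add, Polynomial.eval_mul, Polynomial.eval_C,
          Polynomial.eval_X] at e
        rw [hFs k i (by omega)]
        have hwi : w (i+1) * γ i = w i * β i := by
          rw [hwd, wt]
          have := (hP.hγ i).ne'
          field_simp
        linear_combination hlast + w (i+1) * e - (P i).eval (Λ k) * hwi)
    hn (fun k => a (k+1)) ⟨k - 1, by omega, by rwa [Nat.sub_add_cancel hk.1]⟩
  rw [N_eq_cnt q _ _ ?_ ?_]
  · exact key
  · simp [hF0]
  · intro i hi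
    have : Finset.Icc 1 (n+1) = Finset.Ico 1 (n+2) := by
      ext j; simp only [Finset.mem_Icc, Finset.mem_Ico]; omega
    simp only [this]
    rw [Finset.sum_Ico_eq_sum_range]
    refine Finset.sum_congr rfl fun j _ => ?_
    rw [hFs j i hi, Nat.add_comm 1 j, Nat.add_sub_cancel]

end DiscPaper
end
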